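/- arXiv:2209.09672 — 3 statements merged into one kernel-verified Lean document; each statement's English description precedes it below -/
import Mathlib

section
/- There exist absolute constants c₁, c₂ > 0 such that the following holds. Let d ≤ 3, η ∈ (0, 1/(4−d)), c_V = c₁(1+‖V‖_∞^{1/2})^{−1/2}, and let Ψ be a solution of (−Δ+V)Ψ = EΨ on 𝕋^d_L with ‖Ψ‖_{L²} = 1 and E ∈ [(2c_V/L)^{4/(1+dη)}, min(c_V^{4/(1+dη)}, c₂^{2/(dη)})], L sufficiently large. Suppose Ψ is localized with respect to some x₀ ∈ 𝕋^d_L with localization length ℓ_loc and decay function δ : [1,∞) → [0,1/2], continuous and strictly decreasing. Then ℓ_loc > c_V E^{−1/4+η(1−d/4)} · min(1, E^{−η}/δ^{−1}(E)). -/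
open MeasureTheory Real Filter

noncomputable section

/-- The `i`-th generator of the lattice `L·ℒ₀ = ℤ(L·e₁) ⊕ ℤ(L·γ₁·e₂) ⊕ ⋯ ⊕ ℤ(L·γ_{d-1}·e_d)`. -/
def latVec (d : ℕ) (L : ℝ) (γ : Fin d → ℝ) (i : Fin d) : EuclideanSpace ℝ (Fin d) :=
  EuclideanSpace.single i (L * γ i)

/-- `f : ℝ^d → α` is periodic with respect to the lattice `L·ℒ₀` (equivalently,
it descends to the torus `𝕋^d_L = ℝ^d / L·ℒ₀`). -/
def LatPeriodic {α : Type*} (d : ℕ) (L : ℝ) (γ : Fin d → ℝ)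
    (f : EuclideanSpace ℝ (Fin d) → α) : Prop :=
  ∀ (x : EuclideanSpace ℝ (Fin d)) (i : Fin d), f (x + latVec d L γ i) = f x

/-- A fundamental domain for the torus `𝕋^d_L = ℝ^d / L·ℒ₀`. -/
def fund (d : ℕ) (L : ℝ) (γ : Fin d → ℝ) : Set (EuclideanSpace ℝ (Fin d)) :=
  {x | ∀ i, x i ∈ Set.Ico (0 : ℝ) (L * γ i)}

/-- The quotient (torus) distance on `𝕋^d_L`, computed between representatives in `ℝ^d`. -/
def torusDist (d : ℕ) (L : ℝ) (γ : Fin d → ℝ)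
    (x y : EuclideanSpace ℝ (Fin d)) : ℝ :=
  ⨅ v : Fin d → ℤ, ‖x - y - ∑ i, (v i : ℝ) • latVec d L γ i‖

/-- The (periodized) open ball `B(x₀, ρ)` of the torus metric, as a subset of `ℝ^d`. -/
def torusBall (d : ℕ) (L : ℝ) (γ : Fin d → ℝ)
    (x₀ : EuclideanSpace ℝ (Fin d)) (ρ : ℝ) : Set (EuclideanSpace ℝ (Fin d)) :=
  {x | torusDist d L γ x x₀ < ρ}

/-- The Euclidean Laplacian `Δf = ∑ᵢ ∂²f/∂xᵢ²`. -/
def lap (d : ℕ) (f : EuclideanSpace ℝ (Fin d) → ℂ)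
    (x : EuclideanSpace ℝ (Fin d)) : ℂ :=
  ∑ i, fderiv ℝ (fun y => fderiv ℝ f y (EuclideanSpace.single i 1)) x
      (EuclideanSpace.single i 1)

/-- The squared norm of the gradient, `|∇f|² = ∑ᵢ |∂f/∂xᵢ|²`. -/
def gradSq (d : ℕ) (f : EuclideanSpace ℝ (Fin d) → ℂ)
    (x : EuclideanSpace ℝ (Fin d)) : ℝ :=
  ∑ i, ‖fderiv ℝ f x (EuclideanSpace.single i 1)‖ ^ 2

/-- An `L²`-normalized solution of the stationary Schrödinger equation
`(-Δ + V)Ψ = EΨ` on the torus `𝕋^d_L`. -/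
def IsSolution (d : ℕ) (L : ℝ) (γ : Fin d → ℝ)
    (V : EuclideanSpace ℝ (Fin d) → ℝ) (E : ℝ)
    (Ψ : EuclideanSpace ℝ (Fin d) → ℂ) : Prop :=
  ContDiff ℝ 2 Ψ ∧ LatPeriodic d L γ Ψ ∧
    (∀ x, -lap d Ψ x + (V x : ℂ) * Ψ x = (E : ℂ) * Ψ x) ∧
    (∫ x in fund d L γ, ‖Ψ x‖ ^ 2) = 1

/-- `r_d(n)`: the number of lattice points `ξ ∈ ℤ^d` with `|ξ|² = n`. -/
def rd (d n : ℕ) : ℕ := Nat.card {ξ : Fin d → ℤ // ∑ i, (ξ i) ^ 2 = (n : ℤ)}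

/-- The character `e(ξ·x/r') = e^{2πi ξ·x/r'}`. -/
def ec (d : ℕ) (r' : ℝ) (ξ : Fin d → ℤ) (x : EuclideanSpace ℝ (Fin d)) : ℂ :=
  Complex.exp (2 * Real.pi * Complex.I * (∑ i, (ξ i : ℂ) * (x i : ℂ)) / (r' : ℂ))


lemma aux_setInt (d : ℕ) (L : ℝ) (γ : Fin d → ℝ) (f : EuclideanSpace ℝ (Fin d) → ℝ) :
    ∫ x in fund d L γ, f x =
      ∫ y in Set.Icc (0 : Fin d → ℝ) (fun i => L * γ i), f (WithLp.toLp 2 y) := by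
  have h1 := (PiLp.volume_preserving_toLp (Fin d)).setIntegral_preimage_emb
    (MeasurableEquiv.toLp 2 (Fin d → ℝ)).measurableEmbedding f (fund d L γ)
  rw [← h1]
  have h2 : (WithLp.toLp 2 ⁻¹' fund d L γ : Set (Fin d → ℝ)) =
      Set.pi Set.univ (fun i => Set.Ico ((0 : Fin d → ℝ) i) (L * γ i)) := by
    ext y
    simp [fund, Set.mem_pi]
  rw [h2]
  exact setIntegral_congr_set (Measure.univ_pi_Ico_ae_eq_Icc)

lemma aux_integrable (d : ℕ) (L : ℝ) (γ : Fin d → ℝ) (f : EuclideanSpace ℝ (Fin d) → ℝ)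
    (hf : Continuous f) : IntegrableOn f (fund d L γ) := by
  have hK : IsCompact (WithLp.toLp 2 '' Set.Icc (0 : Fin d → ℝ) (fun i => L * γ i)) :=
    isCompact_Icc.image (PiLp.continuous_toLp 2 _)
  refine (hf.continuousOn.integrableOn_compact hK).mono_set ?_
  intro x hx
  refine ⟨WithLp.ofLp x, ⟨fun i => (hx i).1, fun i => (hx i).2.le⟩, rfl⟩

lemma aux_partial (n : ℕ) (L : ℝ) (γ : Fin (n + 1) → ℝ) (hpos : ∀ i, 0 ≤ L * γ i)
    (F : EuclideanSpace ℝ (Fin (n + 1)) → ℝ) (hF : ContDiff ℝ 1 F)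
    (hper : LatPeriodic (n + 1) L γ F) (i : Fin (n + 1)) :
    ∫ x in fund (n + 1) L γ, fderiv ℝ F x (EuclideanSpace.single i 1) = 0 := by
  rw [aux_setInt]
  let T : (Fin (n + 1) → ℝ) →L[ℝ] EuclideanSpace ℝ (Fin (n + 1)) :=
    (PiLp.continuousLinearEquiv 2 ℝ (fun _ : Fin (n + 1) => ℝ)).symm
  have hT : ∀ y, T y = WithLp.toLp 2 y := fun y => rfl
  have hTc : Continuous (fun y : Fin (n + 1) → ℝ => (WithLp.toLp 2 y)) := PiLp.continuous_toLp 2 _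
  have hs : ∀ j : Fin (n + 1), WithLp.toLp 2 (Pi.single j (1 : ℝ)) = EuclideanSpace.single j (1 : ℝ) :=
    fun j => rfl
  have key := integral_divergence_of_hasFDerivAt_off_countable' (0 : Fin (n + 1) → ℝ)
    (fun i => L * γ i) (fun j => hpos j)
    (fun j y => if j = i then F (WithLp.toLp 2 y) else 0)
    (fun j y => if j = i then (fderiv ℝ F (WithLp.toLp 2 y)).comp T else 0) ∅ Set.countable_empty
    (by
      intro j
      by_cases h : j = i
      · simp only [h, if_true]; exact (hF.continuous.comp hTc).continuousOn
      · simp only [h, if_false]; exact continuousOn_const)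
    (by
      intro x _ j
      by_cases h : j = i
      · simp only [h, if_true]
        have h1 := (hF.differentiable one_ne_zero (WithLp.toLp 2 x)).hasFDerivAt
        exact HasFDerivAt.comp x (g := F) (f := T) h1 T.hasFDerivAt
      · simp only [h, if_false]; exact hasFDerivAt_const _ _)
    (by
      apply ContinuousOn.integrableOn_compact isCompact_Icc
      apply Continuous.continuousOn
      refine continuous_finsetSum _ fun j _ => ?_
      by_cases h : j = i
      · simp only [h, if_true, ContinuousLinearMap.comp_apply, hT]
        exact ((hF.continuous_fderiv one_ne_zero).comp hTc).clm_apply continuous_const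
      · simp only [h, if_false, zero_apply]; exact continuous_const)
  have h3 : ∀ y : Fin (n + 1) → ℝ, (∑ j, (if j = i then (fderiv ℝ F (WithLp.toLp 2 y)).comp T
      else 0) (Pi.single j 1)) = fderiv ℝ F (WithLp.toLp 2 y) (EuclideanSpace.single i 1) := by
    intro y
    rw [Finset.sum_eq_single i]
    · simp only [if_true, ContinuousLinearMap.comp_apply, hT, hs]
    · intro j _ hj; simp [hj]
    · simp
  simp only [h3] at key
  rw [key]
  apply Finset.sum_eq_zero
  intro j _
  by_cases h : j = i
  · subst h
    simp only [if_true]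
    rw [sub_eq_zero]
    congr 1
    ext y
    rw [← hper (WithLp.toLp 2 (j.insertNth ((0 : Fin (n + 1) → ℝ) j) y)) j]
    congr 1
    ext k
    refine Fin.succAboveCases j ?_ (fun k => ?_) k
    · simp [latVec]
    · simp [latVec]
  · simp [h]

lemma aux_open (d : ℕ) (L : ℝ) (γ : Fin d → ℝ) (x₀ : EuclideanSpace ℝ (Fin d)) (ρ : ℝ) :
    torusBall d L γ x₀ ρ = ⋃ v : Fin d → ℤ, {x | ‖x - x₀ - ∑ i, (v i : ℝ) • latVec d L γ i‖ < ρ} := by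
  ext x
  simp only [torusBall, torusDist, Set.mem_iUnion]
  have hb : BddBelow (Set.range fun v : Fin d → ℤ =>
      ‖x - x₀ - ∑ i, (v i : ℝ) • latVec d L γ i‖) := ⟨0, by rintro _ ⟨v, rfl⟩; positivity⟩
  exact ciInf_lt_iff hb

lemma aux_meas (d : ℕ) (L : ℝ) (γ : Fin d → ℝ) (x₀ : EuclideanSpace ℝ (Fin d)) (ρ : ℝ) :
    MeasurableSet (torusBall d L γ x₀ ρ) := by
  rw [aux_open]
  refine (isOpen_iUnion fun v => ?_).measurableSet
  exact isOpen_lt (by fun_prop) continuous_const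

lemma aux_ball (d : ℕ) (L : ℝ) (γ : Fin d → ℝ) (x₀ x : EuclideanSpace ℝ (Fin d)) (ρ : ℝ)
    (hx : x ∈ torusBall d L γ x₀ ρ) (j : Fin d) :
    ∃ k : ℤ, |x j - x₀ j - k * (L * γ j)| < ρ := by
  rw [aux_open] at hx
  obtain ⟨v, hv⟩ := Set.mem_iUnion.1 hx
  refine ⟨v j, lt_of_le_of_lt ?_ hv⟩
  have := PiLp.norm_apply_le (x - x₀ - ∑ i, (v i : ℝ) • latVec d L γ i) j
  rw [Real.norm_eq_abs] at this
  have e : (x - x₀ - ∑ i, (v i : ℝ) • latVec d L γ i) j = x j - x₀ j - v j * (L * γ j) := by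
    simp [latVec, Pi.single_apply]
  rwa [e] at this

/-- conjugate Poisson kernel -/
def hK (ρ θ : ℝ) : ℝ := 2 * Real.arctan (ρ * Real.sin θ / (1 - ρ * Real.cos θ))

def pK (ρ θ : ℝ) : ℝ := (1 - ρ ^ 2) / (1 - 2 * ρ * Real.cos θ + ρ ^ 2)

lemma aux_den (ρ θ : ℝ) (h0 : 0 < ρ) (h1 : ρ < 1) : 0 < 1 - ρ * Real.cos θ := by
  nlinarith [Real.cos_le_one θ]

lemma aux_den2 (ρ θ : ℝ) (h0 : 0 < ρ) (h1 : ρ < 1) : 0 < 1 - 2 * ρ * Real.cos θ + ρ ^ 2 := by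
  nlinarith [Real.cos_le_one θ, sq_pos_of_pos (sub_pos.2 h1)]

lemma hK_contDiff (ρ : ℝ) (h0 : 0 < ρ) (h1 : ρ < 1) : ContDiff ℝ 1 (hK ρ) := by
  unfold hK
  apply ContDiff.mul contDiff_const
  apply Real.contDiff_arctan.comp
  exact ContDiff.div (by fun_prop) (by fun_prop) (fun θ => (aux_den ρ θ h0 h1).ne')

lemma hK_deriv (ρ θ : ℝ) (h0 : 0 < ρ) (h1 : ρ < 1) : HasDerivAt (hK ρ) (pK ρ θ - 1) θ := by
  have hd := aux_den ρ θ h0 h1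
  have hd2 := aux_den2 ρ θ h0 h1
  have e1 : HasDerivAt (fun t => ρ * Real.sin t) (ρ * Real.cos θ) θ :=
    (Real.hasDerivAt_sin θ).const_mul ρ
  have e2 : HasDerivAt (fun t => 1 - ρ * Real.cos t) (-(ρ * -Real.sin θ)) θ :=
    ((Real.hasDerivAt_cos θ).const_mul ρ).const_sub 1
  have e3 := (((e1.fun_div e2 hd.ne').arctan).const_mul 2)
  refine HasDerivAt.congr_deriv e3 ?_
  have hs := Real.sin_sq θ
  have : 1 + (ρ * Real.sin θ / (1 - ρ * Real.cos θ)) ^ 2 =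
      (1 - 2 * ρ * Real.cos θ + ρ ^ 2) / (1 - ρ * Real.cos θ) ^ 2 := by
    field_simp
    rw [hs]; ring
  rw [this]
  unfold pK
  field_simp
  rw [hs]; ring

lemma hK_bound (ρ θ : ℝ) : |hK ρ θ| ≤ π := by
  unfold hK
  rw [abs_le]
  constructor
  · linarith [Real.neg_pi_div_two_lt_arctan (ρ * Real.sin θ / (1 - ρ * Real.cos θ))]
  · linarith [Real.arctan_lt_pi_div_two (ρ * Real.sin θ / (1 - ρ * Real.cos θ))]

lemma hK_per (ρ θ : ℝ) : hK ρ (θ + 2 * π) = hK ρ θ := by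
  simp [hK]

lemma pK_nonneg (ρ θ : ℝ) (h0 : 0 < ρ) (h1 : ρ < 1) : 0 ≤ pK ρ θ :=
  div_nonneg (by nlinarith) (aux_den2 ρ θ h0 h1).le

lemma pK_lower (ρ θ : ℝ) (h0 : 0 < ρ) (h1 : ρ < 1) (k : ℤ)
    (hθ : |θ - k * (2 * π)| ≤ 1 - ρ) : 1 / (2 * (1 - ρ)) ≤ pK ρ θ := by
  have hc : Real.cos θ = Real.cos (θ - k * (2 * π)) := by
    rw [Real.cos_sub_int_mul_two_pi]
  have hb : 1 - (1 - ρ) ^ 2 / 2 ≤ Real.cos θ := by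
    rw [hc]
    have := @Real.one_sub_sq_div_two_le_cos (θ - k * (2 * π))
    have h3 : (θ - k * (2 * π)) ^ 2 ≤ (1 - ρ) ^ 2 := by
      rw [← sq_abs]; gcongr
    linarith
  unfold pK
  have he : 0 < 1 - ρ := by linarith
  rw [div_le_div_iff₀ (by linarith) (aux_den2 ρ θ h0 h1)]
  nlinarith [mul_le_mul_of_nonneg_left hb h0.le, sq_nonneg (1 - ρ), mul_pos h0 (pow_pos he 2)]

lemma aux_arith (d : ℕ) (hd : 0 < d) (hd3 : d ≤ 3) (η : ℝ) (hη : 0 < η)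
    (cV E L ℓ : ℝ) (hcV : 0 < cV) (hcV1 : cV ≤ 1/100) (hL : 0 < L) (hE : 0 < E) (hE1 : E < 1)
    (h1 : (2 * cV / L) ^ ((4:ℝ) / (1 + d * η)) ≤ E)
    (h2 : E ≤ (1/1000 : ℝ) ^ ((2:ℝ) / (d * η)))
    (hℓ : ℓ ≤ cV * E ^ (-(1:ℝ)/4 + η * (1 - (d:ℝ)/4))) :
    ℓ / L ≤ 1/200 ∧ ℓ * √E ≤ 1/100 := by
  have hd' : (0:ℝ) < d := by exact_mod_cast hd
  have hd3' : (d:ℝ) ≤ 3 := by exact_mod_cast hd3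
  have hp : 0 < 1 + d * η := by positivity
  constructor
  · have e1 : 2 * cV / L ≤ E ^ ((1 + d * η) / 4) := by
      have := Real.rpow_le_rpow (by positivity) h1 (show 0 ≤ (1 + d * η) / 4 by positivity)
      rw [← Real.rpow_mul (by positivity)] at this
      rwa [show (4:ℝ) / (1 + d * η) * ((1 + d * η) / 4) = 1 by field_simp, Real.rpow_one] at this
    have e2 : E ^ η ≤ 1/100 := by
      have := Real.rpow_le_rpow hE.le h2 hη.le
      rw [← Real.rpow_mul (by norm_num)] at this
      refine this.trans ?_
      have e3 : (1/1000 : ℝ) ^ ((2:ℝ) / (d * η) * η) ≤ (1/1000 : ℝ) ^ ((2:ℝ)/3) := by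
        apply Real.rpow_le_rpow_of_exponent_ge (by norm_num) (by norm_num)
        rw [show (2:ℝ) / (d * η) * η = 2 / d by field_simp]
        gcongr
      refine e3.trans ?_
      rw [show (1/1000 : ℝ) = (1/10) ^ (3:ℝ) by norm_num, ← Real.rpow_mul (by norm_num)]
      norm_num
    have e4 : ℓ / L ≤ (2 * cV / L) * E ^ (-(1:ℝ)/4 + η * (1 - (d:ℝ)/4)) / 2 := by
      rw [div_le_iff₀ hL]
      calc ℓ ≤ _ := hℓ
        _ = _ := by field_simp
    have e5 : E ^ ((1 + d * η) / 4) * E ^ (-(1:ℝ)/4 + η * (1 - (d:ℝ)/4)) = E ^ η := by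
      rw [← Real.rpow_add hE]; congr 1; ring
    have e6 := mul_le_mul_of_nonneg_right e1 (Real.rpow_nonneg hE.le (-(1:ℝ)/4 + η * (1 - (d:ℝ)/4)))
    linarith
  · rw [Real.sqrt_eq_rpow]
    calc ℓ * E ^ ((1:ℝ)/2) ≤ cV * E ^ (-(1:ℝ)/4 + η * (1 - (d:ℝ)/4)) * E ^ ((1:ℝ)/2) := by gcongr
      _ = cV * E ^ ((1:ℝ)/4 + η * (1 - (d:ℝ)/4)) := by
        rw [mul_assoc, ← Real.rpow_add hE]; congr 2; ring
      _ ≤ cV * 1 := by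
        gcongr
        apply Real.rpow_le_one hE.le hE1.le
        have : 0 ≤ η * (1 - (d:ℝ)/4) := mul_nonneg hη.le (by linarith)
        linarith
      _ ≤ _ := by linarith

lemma aux_core (n : ℕ) (L : ℝ) (γ : Fin (n + 1) → ℝ) (hL : 0 < L) (hγ : ∀ i, 1 ≤ γ i)
    (hγ0 : γ 0 = 1) (V : EuclideanSpace ℝ (Fin (n + 1)) → ℝ) (hV : ∀ x, 0 ≤ V x)
    (E : ℝ) (hE : 0 < E) (Ψ : EuclideanSpace ℝ (Fin (n + 1)) → ℂ)
    (hΨ : IsSolution (n + 1) L γ V E Ψ) (x₀ : EuclideanSpace ℝ (Fin (n + 1))) (ℓ : ℝ)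
    (hℓ : 0 < ℓ) (hℓL : 2 * π * ℓ / L < 1) :
    ∫ x in fund (n + 1) L γ ∩ torusBall (n + 1) L γ x₀ ℓ, ‖Ψ x‖ ^ 2 ≤
      4 * π * (ℓ / L) + 4 * π * (ℓ * √E) := by
  obtain ⟨hC, hper, heq, hnorm⟩ := hΨ
  have hpos : ∀ i, 0 ≤ L * γ i := fun i => mul_nonneg hL.le (by linarith [hγ i])
  set D : Fin (n + 1) → EuclideanSpace ℝ (Fin (n + 1)) → ℂ :=
    fun i x => fderiv ℝ Ψ x (EuclideanSpace.single i 1) with hD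
  have hDC : ∀ i, ContDiff ℝ 1 (D i) := fun i =>
    (hC.fderiv_right (m := 1) (by norm_num)).clm_apply contDiff_const
  have hC1 : ContDiff ℝ 1 Ψ := hC.of_le (by norm_num)
  have hDper : ∀ i, LatPeriodic (n + 1) L γ (D i) := by
    intro i x j
    have h1 : (fun y => Ψ (y + latVec (n + 1) L γ j)) = Ψ := funext fun y => hper y j
    have h2 : fderiv ℝ Ψ (x + latVec (n + 1) L γ j) = fderiv ℝ Ψ x := by
      rw [← fderiv_comp_add_right, h1]
    simp only [hD, h2]
  -- gradient estimate
  have hgc : Continuous (fun x => ‖Ψ x‖ ^ 2) := by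
    have := hC.continuous; fun_prop
  have hgradc : Continuous (gradSq (n + 1) Ψ) := by
    unfold gradSq
    exact continuous_finsetSum _ fun i _ => ((hDC i).continuous.norm.pow 2)
  have hgrad : ∫ x in fund (n + 1) L γ, gradSq (n + 1) Ψ x ≤ E := by
    have hG : ∀ i, ContDiff ℝ 1 (fun x => inner ℝ (Ψ x) (D i x)) := fun i => hC1.inner ℝ (hDC i)
    have hI : ∀ i, ∫ x in fund (n + 1) L γ,
        fderiv ℝ (fun x => inner ℝ (Ψ x) (D i x)) x (EuclideanSpace.single i 1) = 0 := by
      intro i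
      refine aux_partial n L γ hpos _ (hG i) ?_ i
      intro x j
      simp only [hper x j, hDper i x j]
    have hIc : ∀ i, IntegrableOn (fun x =>
        fderiv ℝ (fun x => inner ℝ (Ψ x) (D i x)) x (EuclideanSpace.single i 1))
        (fund (n + 1) L γ) := fun i => aux_integrable _ _ _ _
          (((hG i).continuous_fderiv one_ne_zero).clm_apply continuous_const)
    have hsum : ∫ x in fund (n + 1) L γ, ∑ i,
        fderiv ℝ (fun x => inner ℝ (Ψ x) (D i x)) x (EuclideanSpace.single i 1) = 0 := by
      rw [integral_finsetSum _ fun i _ => hIc i]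
      exact Finset.sum_eq_zero fun i _ => hI i
    have hpt : ∀ x, gradSq (n + 1) Ψ x ≤ (∑ i,
        fderiv ℝ (fun x => inner ℝ (Ψ x) (D i x)) x (EuclideanSpace.single i 1))
          + E * ‖Ψ x‖ ^ 2 := by
      intro x
      have h1 : ∀ i, fderiv ℝ (fun x => inner ℝ (Ψ x) (D i x)) x (EuclideanSpace.single i 1) =
          inner ℝ (Ψ x) (fderiv ℝ (D i) x (EuclideanSpace.single i 1)) + ‖D i x‖ ^ 2 := by
        intro i
        rw [fderiv_inner_apply ℝ (hC1.differentiable one_ne_zero x)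
          ((hDC i).differentiable one_ne_zero x)]
        congr 1
        exact real_inner_self_eq_norm_sq _
      simp only [h1, Finset.sum_add_distrib, ← inner_sum]
      have h2 : (∑ i, fderiv ℝ (D i) x (EuclideanSpace.single i 1)) = ((V x - E : ℝ)) • Ψ x := by
        change lap (n + 1) Ψ x = _
        have := heq x
        rw [Complex.real_smul]
        push_cast
        linear_combination -this
      rw [h2, inner_smul_right, real_inner_self_eq_norm_sq]
      unfold gradSq
      have := mul_nonneg (hV x) (sq_nonneg ‖Ψ x‖)
      simp only [hD]
      linarith
    calc ∫ x in fund (n + 1) L γ, gradSq (n + 1) Ψ x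
        ≤ ∫ x in fund (n + 1) L γ, ((∑ i,
        fderiv ℝ (fun x => inner ℝ (Ψ x) (D i x)) x (EuclideanSpace.single i 1))
          + E * ‖Ψ x‖ ^ 2) := by
          refine integral_mono (aux_integrable _ _ _ _ hgradc) ?_ hpt
          exact (integrable_finsetSum _ fun i _ => hIc i).add
            ((aux_integrable _ _ _ _ hgc).const_mul E)
      _ = E := by
          rw [integral_add (integrable_finsetSum _ fun i _ => hIc i)
            ((aux_integrable _ _ _ _ hgc).const_mul E), hsum, integral_const_mul, hnorm]
          ring
  -- slab estimate
  set ρ : ℝ := 1 - 2 * π * ℓ / L with hρ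
  have hρ0 : 0 < ρ := by linarith
  have hε : 0 < 2 * π * ℓ / L := by positivity
  have hρ1 : ρ < 1 := by linarith
  set θ : EuclideanSpace ℝ (Fin (n + 1)) → ℝ := fun x => (2 * π / L) * (x 0 - x₀ 0) with hθ
  have hθC : ContDiff ℝ 1 θ := by fun_prop
  have hθd : ∀ x, fderiv ℝ θ x (EuclideanSpace.single 0 1) = 2 * π / L := by
    intro x
    have h1 : HasFDerivAt θ ((2 * π / L) •
        (EuclideanSpace.proj 0 : EuclideanSpace ℝ (Fin (n + 1)) →L[ℝ] ℝ)) x :=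
      ((EuclideanSpace.proj (𝕜 := ℝ) (0 : Fin (n + 1))).hasFDerivAt.sub_const (x₀ 0)).const_mul _
    rw [h1.fderiv]
    simp
  have hhC : ContDiff ℝ 1 (fun x => hK ρ (θ x)) := (hK_contDiff ρ hρ0 hρ1).comp hθC
  have hnC : ContDiff ℝ 1 (fun x => ‖Ψ x‖ ^ 2) := hC1.norm_sq ℝ
  have hFC : ContDiff ℝ 1 (fun x => hK ρ (θ x) * ‖Ψ x‖ ^ 2) := hhC.mul hnC
  have hF0 := aux_partial n L γ hpos _ hFC (by
    intro x j
    simp only [hper x j]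
    congr 1
    by_cases hj : j = 0
    · subst hj
      have : θ (x + latVec (n + 1) L γ 0) = θ x + 2 * π := by
        simp only [hθ, latVec, hγ0]
        simp
        field_simp
        ring
      rw [this, hK_per]
    · have : θ (x + latVec (n + 1) L γ j) = θ x := by
        simp [hθ, latVec, Ne.symm hj]
      rw [this]) 0
  have hpc : Continuous (fun x => pK ρ (θ x)) := by
    unfold pK
    refine Continuous.div continuous_const ?_ fun x => (aux_den2 ρ _ hρ0 hρ1).ne'
    have := hθC.continuous
    fun_prop
  have hfd : ∀ x, fderiv ℝ (fun x => hK ρ (θ x) * ‖Ψ x‖ ^ 2) x (EuclideanSpace.single 0 1) =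
      hK ρ (θ x) * (2 * inner ℝ (Ψ x) (D 0 x)) +
        (2 * π / L) * (pK ρ (θ x) - 1) * ‖Ψ x‖ ^ 2 := by
    intro x
    have e1 : HasFDerivAt (fun x => hK ρ (θ x)) ((pK ρ (θ x) - 1) • fderiv ℝ θ x) x :=
      (hK_deriv ρ (θ x) hρ0 hρ1).comp_hasFDerivAt x
        (hθC.differentiable one_ne_zero x).hasFDerivAt
    have e2 := (hC1.differentiable one_ne_zero x).hasFDerivAt.norm_sq
    rw [(e1.fun_mul e2).fderiv]
    simp [hθd, hD]
    ring
  have hsE : 0 < √E := Real.sqrt_pos.2 hE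
  have hlow : ∀ x, (2 * π / L) * (pK ρ (θ x) * ‖Ψ x‖ ^ 2) ≤
      fderiv ℝ (fun x => hK ρ (θ x) * ‖Ψ x‖ ^ 2) x (EuclideanSpace.single 0 1)
      + (2 * π / L + π * √E) * ‖Ψ x‖ ^ 2 + (π / √E) * gradSq (n + 1) Ψ x := by
    intro x
    rw [hfd]
    have a1 : ‖D 0 x‖ ^ 2 ≤ gradSq (n + 1) Ψ x :=
      Finset.single_le_sum (f := fun i => ‖D i x‖ ^ 2) (fun i _ => sq_nonneg _) (Finset.mem_univ 0)
    have a2 := abs_real_inner_le_norm (Ψ x) (D 0 x)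
    have a3 := hK_bound ρ (θ x)
    have a4 : |hK ρ (θ x) * (2 * inner ℝ (Ψ x) (D 0 x))| ≤ π * (2 * (‖Ψ x‖ * ‖D 0 x‖)) := by
      rw [abs_mul, abs_mul, abs_two]
      gcongr
    have a5 : 2 * (‖Ψ x‖ * ‖D 0 x‖) ≤ √E * ‖Ψ x‖ ^ 2 + ‖D 0 x‖ ^ 2 / √E := by
      have : √E * ‖Ψ x‖ ^ 2 + ‖D 0 x‖ ^ 2 / √E - 2 * (‖Ψ x‖ * ‖D 0 x‖)
        = (√E * ‖Ψ x‖ - ‖D 0 x‖) ^ 2 / √E := by field_simp; ring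
      have h3 : 0 ≤ (√E * ‖Ψ x‖ - ‖D 0 x‖) ^ 2 / √E := by positivity
      linarith
    have a6 := mul_le_mul_of_nonneg_left a5 Real.pi_pos.le
    have a7 := neg_abs_le (hK ρ (θ x) * (2 * inner ℝ (Ψ x) (D 0 x)))
    have a8 : (π / √E) * ‖D 0 x‖ ^ 2 ≤ (π / √E) * gradSq (n + 1) Ψ x := by gcongr
    have a9 : π * (‖D 0 x‖ ^ 2 / √E) = (π / √E) * ‖D 0 x‖ ^ 2 := by ring
    linarith
  have i1 : IntegrableOn (fun x => fderiv ℝ (fun x => hK ρ (θ x) * ‖Ψ x‖ ^ 2) x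
      (EuclideanSpace.single 0 1)) (fund (n + 1) L γ) := aux_integrable _ _ _ _
    ((hFC.continuous_fderiv one_ne_zero).clm_apply continuous_const)
  have i2 : IntegrableOn (fun x => (2 * π / L + π * √E) * ‖Ψ x‖ ^ 2) (fund (n + 1) L γ) :=
    (aux_integrable _ _ _ _ hgc).const_mul _
  have i3 : IntegrableOn (fun x => (π / √E) * gradSq (n + 1) Ψ x) (fund (n + 1) L γ) :=
    (aux_integrable _ _ _ _ hgradc).const_mul _
  have i4 : IntegrableOn (fun x => (2 * π / L) * (pK ρ (θ x) * ‖Ψ x‖ ^ 2)) (fund (n + 1) L γ) :=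
    (aux_integrable _ _ _ _ (hpc.mul hgc)).const_mul _
  have up : ∫ x in fund (n + 1) L γ, (2 * π / L) * (pK ρ (θ x) * ‖Ψ x‖ ^ 2) ≤
      2 * π / L + 2 * π * √E := by
    have h12 : IntegrableOn (fun x => fderiv ℝ (fun x => hK ρ (θ x) * ‖Ψ x‖ ^ 2) x
      (EuclideanSpace.single 0 1) + (2 * π / L + π * √E) * ‖Ψ x‖ ^ 2) (fund (n + 1) L γ) :=
      i1.add i2
    have := integral_mono i4 (h12.add i3) hlow
    refine this.trans ?_
    simp only [Pi.add_apply]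
    rw [integral_add h12 i3, integral_add i1 i2, hF0, integral_const_mul,
      integral_const_mul, hnorm]
    have h5 : (π / √E) * ∫ x in fund (n + 1) L γ, gradSq (n + 1) Ψ x ≤ (π / √E) * E := by
      gcongr
    have h6 : (π / √E) * E = π * √E := by
      rw [div_mul_eq_mul_div, mul_div_assoc, Real.div_sqrt]
    linarith
  have hbm := aux_meas (n + 1) L γ x₀ ℓ
  have hfm : MeasurableSet (fund (n + 1) L γ) := by
    unfold fund
    have : {x : EuclideanSpace ℝ (Fin (n + 1)) | ∀ i, x i ∈ Set.Ico (0 : ℝ) (L * γ i)} =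
      ⋂ i, (fun x : EuclideanSpace ℝ (Fin (n + 1)) => x i) ⁻¹' Set.Ico (0 : ℝ) (L * γ i) := by
      ext x; simp
    rw [this]
    refine MeasurableSet.iInter fun i => ?_
    exact (by fun_prop : Measurable (fun x : EuclideanSpace ℝ (Fin (n + 1)) => x i))
      measurableSet_Ico
  have lo : ∫ x in fund (n + 1) L γ ∩ torusBall (n + 1) L γ x₀ ℓ, (1 / (2 * ℓ)) * ‖Ψ x‖ ^ 2 ≤
      ∫ x in fund (n + 1) L γ, (2 * π / L) * (pK ρ (θ x) * ‖Ψ x‖ ^ 2) := by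
    calc _ ≤ ∫ x in fund (n + 1) L γ ∩ torusBall (n + 1) L γ x₀ ℓ,
          (2 * π / L) * (pK ρ (θ x) * ‖Ψ x‖ ^ 2) := by
          refine setIntegral_mono_on
            (((aux_integrable _ _ _ _ hgc).mono_set Set.inter_subset_left).const_mul _)
            (i4.mono_set Set.inter_subset_left) (hfm.inter hbm) ?_
          intro x hx
          obtain ⟨k, hk⟩ := aux_ball _ _ _ _ _ _ hx.2 0
          rw [hγ0, mul_one] at hk
          have hb := pK_lower ρ (θ x) hρ0 hρ1 k (by
            have : θ x - k * (2 * π) = (2 * π / L) * (x 0 - x₀ 0 - k * L) := by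
              simp only [hθ]; field_simp
            rw [this, abs_mul, abs_of_pos (by positivity)]
            have h7 : (2 * π / L) * |x 0 - x₀ 0 - k * L| ≤ (2 * π / L) * ℓ := by gcongr
            have h8 : 1 - ρ = (2 * π / L) * ℓ := by rw [hρ]; ring
            linarith)
          rw [← mul_assoc]
          gcongr
          have h9 : 1 / (2 * ℓ) = (2 * π / L) * (1 / (2 * (1 - ρ))) := by
            rw [hρ, sub_sub_cancel]; field_simp
          rw [h9]
          gcongr
      _ ≤ _ := by
          refine setIntegral_mono_set i4 ?_ (Filter.Eventually.of_forall Set.inter_subset_left)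
          refine Filter.Eventually.of_forall fun x => ?_
          have := pK_nonneg ρ (θ x) hρ0 hρ1
          simp only [Pi.zero_apply]
          positivity
  have fin := lo.trans up
  rw [integral_const_mul, div_mul_eq_mul_div, one_mul, div_le_iff₀ (by positivity)] at fin
  refine fin.trans (le_of_eq ?_)
  ring

/-- **Blow-up of localization length** (general decay, inequality (2.9)): with the absolute
constants and energy conditions of the algebraic delocalization theorem, if `Ψ` is localized
with respect to `x₀` with localization length `ℓ_loc` and continuous strictly decreasing
decay `δ : [1,∞) → [0,1/2]` (i.e. `∫_{𝕋^d_L ∖ B(x₀,r)} |Ψ|² dμ ≤ δ(r/ℓ_loc)` for `r ≥ ℓ_loc`),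
then `ℓ_loc > c_V E^{-1/4+η(1-d/4)} · min(1, E^{-η}/δ⁻¹(E))`, where `s = δ⁻¹(E)` is the
point of `[1,∞)` with `δ(s) = E`. -/
theorem localization_length_lower_bound :
    ∃ c₁ c₂ : ℝ, 0 < c₁ ∧ 0 < c₂ ∧
      ∀ (d : ℕ) (hd : 0 < d), d ≤ 3 →
      ∀ γ : Fin d → ℝ, (∀ i, 1 ≤ γ i) → γ ⟨0, hd⟩ = 1 →
      ∀ η : ℝ, 0 < η → η < 1 / (4 - (d : ℝ)) →
      ∀ Vsup : ℝ, 0 ≤ Vsup →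
      ∀ cV : ℝ, cV = c₁ * (1 + Vsup ^ ((1:ℝ)/2)) ^ (-(1:ℝ)/2) →
      ∃ L₀ : ℝ, 0 < L₀ ∧ ∀ L : ℝ, L₀ ≤ L →
      ∀ V : EuclideanSpace ℝ (Fin d) → ℝ,
        Measurable V → (∀ x, 0 ≤ V x) → (∀ x, V x ≤ Vsup) → LatPeriodic d L γ V →
      ∀ E : ℝ, 0 < E → E < 1 →
        (2 * cV / L) ^ ((4:ℝ) / (1 + d * η)) ≤ E →
        E ≤ min (cV ^ ((4:ℝ) / (1 + d * η))) (c₂ ^ ((2:ℝ) / (d * η))) →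
      ∀ Ψ : EuclideanSpace ℝ (Fin d) → ℂ, IsSolution d L γ V E Ψ →
      ∀ (x₀ : EuclideanSpace ℝ (Fin d)) (ℓloc : ℝ), 0 < ℓloc →
      ∀ δ : ℝ → ℝ, ContinuousOn δ (Set.Ici 1) → StrictAntiOn δ (Set.Ici 1) →
        (∀ r, 1 ≤ r → δ r ∈ Set.Icc 0 (1/2)) →
        (∀ r, ℓloc ≤ r →
          (∫ x in fund d L γ \ torusBall d L γ x₀ r, ‖Ψ x‖ ^ 2) ≤ δ (r / ℓloc)) →
      ∀ s : ℝ, 1 ≤ s → δ s = E →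
        ℓloc > cV * E ^ (-(1:ℝ)/4 + η * (1 - (d:ℝ)/4)) * min 1 (E ^ (-η) / s) := by
  refine ⟨1/100, 1/1000, by norm_num, by norm_num, ?_⟩
  intro d hd hd3 γ hγ hγ0 η hη _ Vsup hVs cV hcV
  refine ⟨1, one_pos, ?_⟩
  intro L hL V _ hV _ _ E hE hE1 h1 h2 Ψ hΨ x₀ ℓ hℓ δ _ _ hδ hloc s hs _
  have hL0 : 0 < L := by linarith
  have hb : 1 ≤ 1 + Vsup ^ ((1:ℝ)/2) := by
    have := Real.rpow_nonneg hVs ((1:ℝ)/2)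
    linarith
  have hcV0 : 0 < cV := by rw [hcV]; positivity
  have hcV1 : cV ≤ 1/100 := by
    rw [hcV]
    have := Real.rpow_le_one_of_one_le_of_nonpos hb (show -(1:ℝ)/2 ≤ 0 by norm_num)
    linarith
  by_contra hcon
  have hcon := not_lt.1 hcon
  have hℓ' : ℓ ≤ cV * E ^ (-(1:ℝ)/4 + η * (1 - (d:ℝ)/4)) := by
    refine hcon.trans ?_
    exact mul_le_of_le_one_right (by positivity) (min_le_left _ _)
  obtain ⟨hA, hB⟩ := aux_arith d hd hd3 η hη cV E L ℓ hcV0 hcV1 hL0 hE hE1 h1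
    (h2.trans (min_le_right _ _)) hℓ'
  obtain ⟨n, rfl⟩ : ∃ n, d = n + 1 := ⟨d - 1, by omega⟩
  have hπ : π < 3.15 := Real.pi_lt_d2
  have hπ0 := Real.pi_pos
  have hA0 : 0 < ℓ / L := by positivity
  have hcore := aux_core n L γ hL0 hγ hγ0 V hV E hE Ψ hΨ x₀ ℓ hℓ (by
    rw [mul_div_assoc]; nlinarith)
  have hout := hloc ℓ le_rfl
  rw [div_self hℓ.ne'] at hout
  have hδ1 := (hδ 1 le_rfl).2
  have hgc : Continuous (fun x => ‖Ψ x‖ ^ 2) := by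
    have := hΨ.1.continuous; fun_prop
  have hsplit := integral_inter_add_sdiff (aux_meas (n + 1) L γ x₀ ℓ)
    (aux_integrable (n + 1) L γ _ hgc)
  have hnorm := hΨ.2.2.2
  have q1 : 4 * π * (ℓ / L) ≤ 4 * π * (1/200) := by gcongr
  have q2 : 4 * π * (ℓ * √E) ≤ 4 * π * (1/100) := by gcongr
  linarith
end
end

section
/- There exist absolute constants c₁, c₂ > 0 such that the following holds. Let d ≤ 3, η ∈ (0, 1/(4−d)), c_V = c₁(1+‖V‖_∞^{1/2})^{−1/2}, and let Ψ be a solution of (−Δ+V)Ψ = EΨ on 𝕋^d_L with ‖Ψ‖_{L²} = 1 and E ∈ [(2c_V/L)^{4/(1+dη)}, min(c_V^{4/(1+dη)}, c₂^{2/(dη)})], L sufficiently large. Suppose there are constants C > 1/2 and β > 0 and a point x₀ ∈ 𝕋^d_L such that for all r ≥ ℓ_loc := log(2C)/β one has ∫_{𝕋^d_L ∖ B(x₀,r)} |Ψ|² dμ ≤ C e^{−βr} (exponential localization). If moreover E < C, then ℓ_loc > c_V E^{−1/4+η(1−d/4)} · min(1, log(2C) · E^{−η} / log(C/E)). -/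
open MeasureTheory Real Filter

noncomputable section

lemma fund_integrableOn {d : ℕ} (L : ℝ) (γ : Fin d → ℝ) (F : EuclideanSpace ℝ (Fin d) → ℝ)
    (hF : Continuous F) : IntegrableOn F (fund d L γ) := by
  have hK : IsCompact ((WithLp.toLp 2 : (Fin d → ℝ) → EuclideanSpace ℝ (Fin d)) ''
      (Set.pi Set.univ (fun i => Set.Icc (0:ℝ) (L * γ i)))) :=
    (isCompact_univ_pi (fun i => isCompact_Icc)).image (PiLp.continuous_toLp 2 _)
  refine (hF.continuousOn.integrableOn_compact hK).mono_set ?_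
  intro x hx
  refine ⟨WithLp.ofLp x, ?_, rfl⟩
  intro i _
  exact ⟨(hx i).1, (hx i).2.le⟩

lemma fund_measurable {d : ℕ} (L : ℝ) (γ : Fin d → ℝ) : MeasurableSet (fund d L γ) := by
  have : fund d L γ = ⋂ i, (fun x : EuclideanSpace ℝ (Fin d) => x i) ⁻¹' Set.Ico 0 (L * γ i) := by
    ext x; simp [fund]
  rw [this]
  refine MeasurableSet.iInter fun i => ?_
  exact (by fun_prop : Continuous fun x : EuclideanSpace ℝ (Fin d) => x i).measurable measurableSet_Ico

/-- base point of a line in direction `i` -/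
def bpt {n : ℕ} (i : Fin (n+1)) (y : Fin n → ℝ) : EuclideanSpace ℝ (Fin (n+1)) :=
  WithLp.toLp 2 (i.insertNth 0 y)

lemma slice_formula {n : ℕ} (L : ℝ) (γ : Fin (n+1) → ℝ) (i : Fin (n+1))
    (F : EuclideanSpace ℝ (Fin (n+1)) → ℝ) (hF : IntegrableOn F (fund (n+1) L γ)) :
    Integrable (fun y : Fin n → ℝ => ∫ t in Set.Ico 0 (L * γ i), F (bpt i y + t • EuclideanSpace.single i 1))
      (volume.restrict (Set.pi Set.univ fun j => Set.Ico 0 (L * γ (i.succAbove j)))) ∧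
    ∫ x in fund (n+1) L γ, F x =
      ∫ y in (Set.pi Set.univ fun j => Set.Ico 0 (L * γ (i.succAbove j))),
        ∫ t in Set.Ico 0 (L * γ i), F (bpt i y + t • EuclideanSpace.single i 1) := by
  let e : (ℝ × (Fin n → ℝ)) ≃ᵐ EuclideanSpace ℝ (Fin (n+1)) :=
    (MeasurableEquiv.piFinSuccAbove (fun _ => ℝ) i).symm.trans (MeasurableEquiv.toLp 2 (Fin (n+1) → ℝ))
  have he : MeasurePreserving e volume volume :=
    (volume_preserving_piFinSuccAbove (fun _ : Fin (n + 1) => ℝ) i).symm.trans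
      (PiLp.volume_preserving_toLp (Fin (n+1)))
  have hev : ∀ t y, e (t, y) = bpt i y + t • EuclideanSpace.single i 1 := by
    intro t y
    have h1 : e (t, y) = WithLp.toLp 2 (i.insertNth t y) := rfl
    rw [h1]
    ext j
    refine Fin.succAboveCases i ?_ ?_ j
    · simp [bpt]
    · intro k; simp [bpt]
  have hpre : e ⁻¹' (fund (n+1) L γ) = Set.Ico 0 (L * γ i) ×ˢ
      (Set.pi Set.univ fun j => Set.Ico 0 (L * γ (i.succAbove j))) := by
    ext ⟨t, y⟩
    simp only [Set.mem_preimage, Set.mem_prod, Set.mem_pi, Set.mem_univ, forall_true_left, fund, Set.mem_setOf_eq]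
    rw [i.forall_iff_succAbove]
    have h1 : e (t, y) = WithLp.toLp 2 (i.insertNth t y) := rfl
    rw [h1]; simp
  have hint : IntegrableOn (fun p : ℝ × (Fin n → ℝ) => F (e p)) (Set.Ico 0 (L * γ i) ×ˢ
      (Set.pi Set.univ fun j => Set.Ico 0 (L * γ (i.succAbove j)))) := by
    rw [← hpre]
    exact (he.integrableOn_comp_preimage e.measurableEmbedding).2 hF
  have hint2 : Integrable (fun p : (Fin n → ℝ) × ℝ => F (e p.swap))
      ((volume.restrict (Set.pi Set.univ fun j => Set.Ico 0 (L * γ (i.succAbove j)))).prod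
      (volume.restrict (Set.Ico 0 (L * γ i)))) := by
    rw [IntegrableOn, Measure.volume_eq_prod, ← Measure.prod_restrict] at hint
    exact hint.swap
  constructor
  · have := hint2.integral_prod_left
    simpa only [Prod.swap_prod_mk, hev] using this
  · rw [← he.setIntegral_preimage_emb e.measurableEmbedding, hpre, Measure.volume_eq_prod,
      ← Measure.prod_restrict, ← integral_prod_swap, integral_prod _ hint2]
    simp only [Prod.swap_prod_mk, hev]

lemma slice_mono {n : ℕ} (L : ℝ) (γ : Fin (n+1) → ℝ) (i : Fin (n+1))
    (F H : EuclideanSpace ℝ (Fin (n+1)) → ℝ) (hF : IntegrableOn F (fund (n+1) L γ))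
    (hH : IntegrableOn H (fund (n+1) L γ))
    (h : ∀ b : EuclideanSpace ℝ (Fin (n+1)), b i = 0 →
      ∫ t in Set.Ico 0 (L * γ i), F (b + t • EuclideanSpace.single i 1) ≤
      ∫ t in Set.Ico 0 (L * γ i), H (b + t • EuclideanSpace.single i 1)) :
    ∫ x in fund (n+1) L γ, F x ≤ ∫ x in fund (n+1) L γ, H x := by
  obtain ⟨a, b⟩ := slice_formula L γ i F hF
  obtain ⟨a', b'⟩ := slice_formula L γ i H hH
  rw [b, b']
  exact integral_mono a a' fun y => h _ (by simp [bpt])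

lemma circ_vol (L a r : ℝ) (hL : 0 < L) (hr : 0 ≤ r) :
    MeasurableSet {t : ℝ | ‖((t - a : ℝ) : AddCircle L)‖ ≤ r} ∧
    (volume ({t : ℝ | ‖((t - a : ℝ) : AddCircle L)‖ ≤ r} ∩ Set.Ico 0 L)).toReal ≤ 2 * r := by
  haveI : Fact (0 < L) := ⟨hL⟩
  have hS : {t : ℝ | ‖((t - a : ℝ) : AddCircle L)‖ ≤ r} =
      ((↑) : ℝ → AddCircle L) ⁻¹' (Metric.closedBall (a : AddCircle L) r) := by
    ext t; simp [dist_eq_norm]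
  have hm : MeasurableSet {t : ℝ | ‖((t - a : ℝ) : AddCircle L)‖ ≤ r} := by
    rw [hS]; exact AddCircle.measurable_mk' Metric.isClosed_closedBall.measurableSet
  refine ⟨hm, ?_⟩
  have h1 := (AddCircle.measurePreserving_mk L 0).measure_preimage
    (Metric.isClosed_closedBall (x := (a : AddCircle L)) (ε := r)).measurableSet.nullMeasurableSet
  rw [← hS, zero_add, ← restrict_Ico_eq_restrict_Ioc, Measure.restrict_apply hm,
    AddCircle.volume_closedBall] at h1
  rw [h1]
  exact ENNReal.toReal_le_of_le_ofReal (by positivity) (ENNReal.ofReal_le_ofReal (min_le_right _ _))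

lemma one_dim (L r : ℝ) (hL : 0 < L) (hr : 0 ≤ r) (S : Set ℝ) (hS : MeasurableSet S)
    (hv : (volume (S ∩ Set.Ico 0 L)).toReal ≤ 2 * r)
    (g g' k : ℝ → ℝ) (hg : ∀ t, HasDerivAt g (g' t) t) (hg' : Continuous g') (hk : Continuous k)
    (hg0 : ∀ t, 0 ≤ g t) (hgk : ∀ t, |g' t| ≤ k t) :
    ∫ t in Set.Ico 0 L, S.indicator g t ≤ ∫ t in Set.Ico 0 L, 2 * r * (g t / L + k t) := by
  have hgc : Continuous g := continuous_iff_continuousAt.2 fun t => (hg t).continuousAt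
  have hk0 : ∀ t, 0 ≤ k t := fun t => (abs_nonneg _).trans (hgk t)
  have key : ∀ s ∈ Set.Icc 0 L, ∀ t ∈ Set.Icc 0 L, g t ≤ g s + ∫ u in (0:ℝ)..L, k u := by
    intro s hs t ht
    have h1 : ∫ u in s..t, g' u = g t - g s :=
      intervalIntegral.integral_eq_sub_of_hasDerivAt (fun u _ => hg u) (hg'.intervalIntegrable _ _)
    have h2 : |∫ u in s..t, g' u| ≤ |∫ u in s..t, k u| := by
      have := intervalIntegral.norm_integral_le_abs_of_norm_le (f := g') (g := k) (a := s) (b := t) (μ := volume)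
        (by filter_upwards with u using hgk u) (hk.intervalIntegrable _ _)
      simpa using this
    have h3 : |∫ u in s..t, k u| ≤ |∫ u in (0:ℝ)..L, k u| := by
      refine intervalIntegral.abs_integral_mono_interval ?_ ?_ (hk.intervalIntegrable _ _)
      · rw [Set.uIoc_of_le hL.le]
        intro u hu
        rw [Set.mem_uIoc] at hu
        rcases hu with hu | hu
        · exact ⟨hs.1.trans_lt hu.1, hu.2.trans ht.2⟩
        · exact ⟨ht.1.trans_lt hu.1, hu.2.trans hs.2⟩
      · filter_upwards with u using hk0 u
    have h4 : 0 ≤ ∫ u in (0:ℝ)..L, k u := intervalIntegral.integral_nonneg hL.le fun u _ => hk0 u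
    rw [abs_of_nonneg h4] at h3
    have := le_abs_self (∫ u in s..t, g' u)
    linarith
  set K := ∫ u in (0:ℝ)..L, k u with hK
  set G := ∫ u in (0:ℝ)..L, g u with hG
  have hM : ∀ t ∈ Set.Icc 0 L, g t ≤ G / L + K := by
    intro t ht
    have h1 : ∫ s in (0:ℝ)..L, g t ≤ ∫ s in (0:ℝ)..L, (g s + K) :=
      intervalIntegral.integral_mono_on hL.le (by simp) ((hgc.add continuous_const).intervalIntegrable _ _)
        fun s hs => key s hs t ht
    rw [intervalIntegral.integral_add (hgc.intervalIntegrable _ _) (by simp)] at h1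
    simp only [intervalIntegral.integral_const, smul_eq_mul, sub_zero] at h1
    rw [← hG] at h1
    rw [← mul_le_mul_iff_right₀ hL]
    field_simp
    linarith
  have hG0 : 0 ≤ G := intervalIntegral.integral_nonneg hL.le fun u _ => hg0 u
  have hK0 : 0 ≤ K := intervalIntegral.integral_nonneg hL.le fun u _ => hk0 u
  have hR : ∫ t in Set.Ico 0 L, 2 * r * (g t / L + k t) = 2 * r * (G / L + K) := by
    rw [restrict_Ico_eq_restrict_Ioc, ← intervalIntegral.integral_of_le hL.le,
      intervalIntegral.integral_const_mul,
      intervalIntegral.integral_add ((hgc.div_const _).intervalIntegrable _ _) (hk.intervalIntegrable _ _),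
      intervalIntegral.integral_div]
  rw [hR]
  have hvS : volume (S ∩ Set.Ico 0 L) ≠ ⊤ :=
    ((measure_mono Set.inter_subset_right).trans_lt (by simp)).ne
  calc ∫ t in Set.Ico 0 L, S.indicator g t = ∫ t in S ∩ Set.Ico 0 L, g t := by
        rw [integral_indicator hS, Measure.restrict_restrict hS]
    _ ≤ ∫ t in S ∩ Set.Ico 0 L, (G / L + K) := by
        refine setIntegral_mono_on ?_ ?_ (hS.inter measurableSet_Ico) ?_
        · exact (hgc.continuousOn.integrableOn_compact (isCompact_Icc (a := 0) (b := L))).mono_set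
            (Set.inter_subset_right.trans Set.Ico_subset_Icc_self)
        · exact integrableOn_const hvS
        · intro t ht; exact hM t ⟨ht.2.1, ht.2.2.le⟩
    _ = (volume (S ∩ Set.Ico 0 L)).toReal * (G / L + K) := by simp [Measure.real]
    _ ≤ 2 * r * (G / L + K) := by gcongr

lemma line_deriv {d : ℕ} {W : Type*} [NormedAddCommGroup W] [NormedSpace ℝ W]
    (F : EuclideanSpace ℝ (Fin d) → W) (hF : ContDiff ℝ 1 F)
    (b v : EuclideanSpace ℝ (Fin d)) (t : ℝ) :
    HasDerivAt (fun t : ℝ => F (b + t • v)) (fderiv ℝ F (b + t • v) v) t := by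
  have h1 : HasFDerivAt F (fderiv ℝ F (b + t • v)) (b + t • v) :=
    ((hF.differentiable one_ne_zero) _).hasFDerivAt
  have h2 : HasDerivAt (fun t : ℝ => b + t • v) v t := by
    simpa using ((hasDerivAt_id t).smul_const v).const_add b
  exact h1.comp_hasDerivAt t h2

lemma dir_contDiff {d : ℕ} (Ψ : EuclideanSpace ℝ (Fin d) → ℂ) (h : ContDiff ℝ 2 Ψ)
    (v : EuclideanSpace ℝ (Fin d)) : ContDiff ℝ 1 (fun y => fderiv ℝ Ψ y v) :=
  (h.fderiv_right (m := 1) (by norm_num)).clm_apply contDiff_const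

lemma parts {n : ℕ} (L : ℝ) (hL : 0 < L) (γ : Fin (n+1) → ℝ) (hγ : ∀ i, 1 ≤ γ i)
    (Ψ : EuclideanSpace ℝ (Fin (n+1)) → ℂ) (h : ContDiff ℝ 2 Ψ) (hp : LatPeriodic (n+1) L γ Ψ)
    (i : Fin (n+1)) :
    Continuous (fun x => inner ℝ (Ψ x) (fderiv ℝ (fun y => fderiv ℝ Ψ y (EuclideanSpace.single i 1)) x
      (EuclideanSpace.single i 1)) + ‖fderiv ℝ Ψ x (EuclideanSpace.single i 1)‖ ^ 2) ∧
    ∫ x in fund (n+1) L γ, (inner ℝ (Ψ x) (fderiv ℝ (fun y => fderiv ℝ Ψ y (EuclideanSpace.single i 1)) x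
      (EuclideanSpace.single i 1)) + ‖fderiv ℝ Ψ x (EuclideanSpace.single i 1)‖ ^ 2) ≤ 0 := by
  set v : EuclideanSpace ℝ (Fin (n+1)) := EuclideanSpace.single i 1 with hv
  set D : EuclideanSpace ℝ (Fin (n+1)) → ℂ := fun y => fderiv ℝ Ψ y v with hD
  have hDc : ContDiff ℝ 1 D := dir_contDiff Ψ h v
  have hc : Continuous fun x => fderiv ℝ D x v :=
    (hDc.continuous_fderiv one_ne_zero).clm_apply continuous_const
  have hcont : Continuous (fun x => inner ℝ (Ψ x) (fderiv ℝ D x v) + ‖D x‖ ^ 2) :=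
    (h.continuous.inner hc).add (hDc.continuous.norm.pow 2)
  refine ⟨hcont, ?_⟩
  have hLi : 0 < L * γ i := mul_pos hL (by linarith [hγ i])
  have hlat : latVec (n+1) L γ i = (L * γ i) • v := by
    ext j; simp [latVec, hv, EuclideanSpace.single_apply]
  have hpD : ∀ x, D (x + (L * γ i) • v) = D x := by
    intro x
    have : (fun y => Ψ (y + (L * γ i) • v)) = Ψ := by
      funext y; rw [← hlat]; exact hp y i
    simp only [hD]
    rw [← fderiv_comp_add_right, this]
  have := slice_mono L γ i (fun x => inner ℝ (Ψ x) (fderiv ℝ D x v) + ‖D x‖ ^ 2) (fun _ => 0)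
    (fund_integrableOn L γ _ hcont) (by simp) ?_
  · simpa using this
  intro b _
  have hder : ∀ t, HasDerivAt (fun t : ℝ => inner ℝ (Ψ (b + t • v)) (D (b + t • v)))
      (inner ℝ (Ψ (b + t • v)) (fderiv ℝ D (b + t • v) v) + ‖D (b + t • v)‖ ^ 2) t := by
    intro t
    have := (line_deriv Ψ (h.of_le (by norm_num)) b v t).inner ℝ (line_deriv D hDc b v t)
    rw [← real_inner_self_eq_norm_sq]
    exact this
  rw [restrict_Ico_eq_restrict_Ioc, ← intervalIntegral.integral_of_le hLi.le,
    ← intervalIntegral.integral_of_le hLi.le,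
    intervalIntegral.integral_eq_sub_of_hasDerivAt (fun u _ => hder u)]
  · rw [hpD, ← hlat, hp]; simp
  · exact (hcont.comp (by fun_prop : Continuous fun t : ℝ => b + t • v)).intervalIntegrable _ _

lemma energy {n : ℕ} (L : ℝ) (hL : 0 < L) (γ : Fin (n+1) → ℝ) (hγ : ∀ i, 1 ≤ γ i)
    (V : EuclideanSpace ℝ (Fin (n+1)) → ℝ) (hV : ∀ x, 0 ≤ V x) (E : ℝ)
    (Ψ : EuclideanSpace ℝ (Fin (n+1)) → ℂ) (h : IsSolution (n+1) L γ V E Ψ) (i : Fin (n+1)) :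
    ∫ x in fund (n+1) L γ, ‖fderiv ℝ Ψ x (EuclideanSpace.single i 1)‖ ^ 2 ≤ E := by
  obtain ⟨h1, h2, h3, h4⟩ := h
  have hP := parts L hL γ hγ Ψ h1 h2
  have hsum : ∫ x in fund (n+1) L γ, ∑ j, (inner ℝ (Ψ x) (fderiv ℝ (fun y => fderiv ℝ Ψ y (EuclideanSpace.single j 1)) x
      (EuclideanSpace.single j 1)) + ‖fderiv ℝ Ψ x (EuclideanSpace.single j 1)‖ ^ 2) ≤ 0 := by
    rw [integral_finsetSum]
    · exact Finset.sum_nonpos fun j _ => (hP j).2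
    · intro j _; exact fund_integrableOn L γ _ (hP j).1
  have hΨc : Continuous fun x => ‖Ψ x‖ ^ 2 := h1.continuous.norm.pow 2
  have hDc : Continuous fun x => ‖fderiv ℝ Ψ x (EuclideanSpace.single i 1)‖ ^ 2 :=
    (dir_contDiff Ψ h1 _).continuous.norm.pow 2
  have hle : ∫ x in fund (n+1) L γ, (‖fderiv ℝ Ψ x (EuclideanSpace.single i 1)‖ ^ 2 - E * ‖Ψ x‖ ^ 2) ≤ 0 := by
    refine le_trans (integral_mono (fund_integrableOn L γ _ (hDc.sub (continuous_const.mul hΨc)))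
      (fund_integrableOn L γ _ (continuous_finsetSum _ fun j _ => (hP j).1)) ?_) hsum
    intro x
    simp only
    rw [Finset.sum_add_distrib, ← inner_sum]
    have e1 : (∑ j, fderiv ℝ (fun y => fderiv ℝ Ψ y (EuclideanSpace.single j 1)) x
      (EuclideanSpace.single j 1)) = (V x - E : ℝ) • Ψ x := by
      have := h3 x
      rw [lap] at this
      rw [Complex.real_smul]; push_cast
      linear_combination -this
    rw [e1, inner_smul_right, real_inner_self_eq_norm_sq]
    have e2 := Finset.single_le_sum (f := fun j => ‖fderiv ℝ Ψ x (EuclideanSpace.single j 1)‖ ^ 2)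
      (fun j _ => by positivity) (Finset.mem_univ i)
    have e3 := mul_nonneg (hV x) (sq_nonneg ‖Ψ x‖)
    beta_reduce at e2
    nlinarith
  rw [integral_sub (fund_integrableOn L γ _ hDc) ((fund_integrableOn L γ _ hΨc).const_mul E),
    integral_const_mul, h4] at hle
  linarith

lemma slab_mass {n : ℕ} (L : ℝ) (hL : 0 < L) (γ : Fin (n+1) → ℝ) (hγ : ∀ i, 1 ≤ γ i) (hγ0 : γ 0 = 1)
    (V : EuclideanSpace ℝ (Fin (n+1)) → ℝ) (hV : ∀ x, 0 ≤ V x) (E : ℝ) (hE : 0 < E)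
    (Ψ : EuclideanSpace ℝ (Fin (n+1)) → ℂ) (h : IsSolution (n+1) L γ V E Ψ)
    (x₀ : EuclideanSpace ℝ (Fin (n+1))) (r : ℝ) (hr : 0 ≤ r) :
    1 ≤ (∫ x in fund (n+1) L γ \ torusBall (n+1) L γ x₀ r, ‖Ψ x‖ ^ 2) + 2 * r * (1 / L + 2 * √E) := by
  have hen := energy L hL γ hγ V hV E Ψ h 0
  obtain ⟨h1, h2, h3, h4⟩ := h
  set v : EuclideanSpace ℝ (Fin (n+1)) := EuclideanSpace.single 0 1 with hv
  obtain ⟨hSm, hSv⟩ := circ_vol L (x₀ 0) r hL hr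
  set S := {t : ℝ | ‖((t - x₀ 0 : ℝ) : AddCircle L)‖ ≤ r} with hS
  set T : Set (EuclideanSpace ℝ (Fin (n+1))) := (fun x => x 0) ⁻¹' S with hT
  have hTm : MeasurableSet T :=
    (by fun_prop : Continuous fun x : EuclideanSpace ℝ (Fin (n+1)) => x 0).measurable hSm
  have hΨc : Continuous fun x => ‖Ψ x‖ ^ 2 := h1.continuous.norm.pow 2
  have hDc : Continuous fun x => ‖fderiv ℝ Ψ x v‖ ^ 2 :=
    (dir_contDiff Ψ h1 _).continuous.norm.pow 2
  have hΨi := fund_integrableOn L γ _ hΨc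
  have hDi := fund_integrableOn L γ _ hDc
  have hsub : torusBall (n+1) L γ x₀ r ⊆ T := by
    intro x hx
    have hx' : torusDist (n+1) L γ x x₀ < r := hx
    obtain ⟨w, hw⟩ := exists_lt_of_ciInf_lt hx'
    have e1 := (PiLp.norm_apply_le (x - x₀ - ∑ i, (w i : ℝ) • latVec (n+1) L γ i) 0).trans hw.le
    have e2 : (x - x₀ - ∑ i, (w i : ℝ) • latVec (n+1) L γ i) 0 = x 0 - x₀ 0 - w 0 * L := by
      simp [latVec, Finset.sum_apply, Pi.single_apply, hγ0]
    rw [e2] at e1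
    change ‖((x 0 - x₀ 0 : ℝ) : AddCircle L)‖ ≤ r
    have e3 : ((x 0 - x₀ 0 : ℝ) : AddCircle L) = ((x 0 - x₀ 0 - w 0 * L : ℝ) : AddCircle L) := by
      have : ((w 0 * L : ℝ) : AddCircle L) = 0 := by
        rw [← zsmul_eq_mul, AddCircle.coe_zsmul, AddCircle.coe_period, smul_zero]
      rw [AddCircle.coe_sub L (x 0 - x₀ 0) (w 0 * L : ℝ), this, sub_zero]
    rw [e3]
    exact (QuotientAddGroup.norm_mk_le_norm).trans e1
  have hout : ∫ x in fund (n+1) L γ \ T, ‖Ψ x‖ ^ 2 ≤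
      ∫ x in fund (n+1) L γ \ torusBall (n+1) L γ x₀ r, ‖Ψ x‖ ^ 2 := by
    refine setIntegral_mono_set (hΨi.mono_set Set.diff_subset) ?_ ?_
    · exact Filter.Eventually.of_forall fun x => by positivity
    · exact (Set.diff_subset_diff_right hsub).eventuallyLE
  have hsplit := integral_inter_add_diff (μ := volume) hTm hΨi
  rw [h4] at hsplit
  have hsE : 0 < √E := Real.sqrt_pos.2 hE
  have hkc : Continuous fun x => √E * ‖Ψ x‖ ^ 2 + ‖fderiv ℝ Ψ x v‖ ^ 2 / √E :=
    (continuous_const.mul hΨc).add (hDc.div_const _)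
  have hin : ∫ x in fund (n+1) L γ ∩ T, ‖Ψ x‖ ^ 2 ≤
      ∫ x in fund (n+1) L γ, 2 * r * (‖Ψ x‖ ^ 2 / L + (√E * ‖Ψ x‖ ^ 2 + ‖fderiv ℝ Ψ x v‖ ^ 2 / √E)) := by
    have e1 : ∫ x in fund (n+1) L γ ∩ T, ‖Ψ x‖ ^ 2 =
        ∫ x in fund (n+1) L γ, T.indicator (fun x => ‖Ψ x‖ ^ 2) x := by
      rw [integral_indicator hTm, Measure.restrict_restrict hTm, Set.inter_comm]
    rw [e1]
    refine slice_mono L γ 0 _ _ (hΨi.indicator hTm) (fund_integrableOn L γ _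
      (continuous_const.mul ((hΨc.div_const _).add hkc))) ?_
    intro b hb
    rw [hγ0, mul_one]
    have hline : Continuous fun t : ℝ => b + t • v := by fun_prop
    have hind : ∀ t : ℝ, T.indicator (fun x => ‖Ψ x‖ ^ 2) (b + t • v) =
        S.indicator (fun t => ‖Ψ (b + t • v)‖ ^ 2) t := by
      intro t
      have : (b + t • v ∈ T) ↔ t ∈ S := by
        change (b + t • v) 0 ∈ S ↔ t ∈ S
        simp [hv, hb]
      by_cases ht : t ∈ S
      · rw [Set.indicator_of_mem ht, Set.indicator_of_mem (this.2 ht)]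
      · rw [Set.indicator_of_notMem ht, Set.indicator_of_notMem (fun q => ht (this.1 q))]
    rw [← hv]
    simp only [hind]
    refine one_dim L r hL hr S hSm hSv (fun t => ‖Ψ (b + t • v)‖ ^ 2)
      (fun t => 2 * inner ℝ (Ψ (b + t • v)) (fderiv ℝ Ψ (b + t • v) v))
      (fun t => √E * ‖Ψ (b + t • v)‖ ^ 2 + ‖fderiv ℝ Ψ (b + t • v) v‖ ^ 2 / √E) ?_ ?_ ?_ ?_ ?_
    · intro t
      exact (line_deriv Ψ (h1.of_le (by norm_num)) b v t).norm_sq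
    · exact continuous_const.mul ((h1.continuous.comp hline).inner
        ((dir_contDiff Ψ h1 v).continuous.comp hline))
    · exact hkc.comp hline
    · intro t; positivity
    · intro t
      have q1 := abs_real_inner_le_norm (Ψ (b + t • v)) (fderiv ℝ Ψ (b + t • v) v)
      rw [abs_mul, abs_two]
      set p := ‖Ψ (b + t • v)‖
      set q := ‖fderiv ℝ Ψ (b + t • v) v‖
      have q2 : 2 * (p * q) ≤ √E * p ^ 2 + q ^ 2 / √E := by
        have : 0 ≤ (√E * p - q) ^ 2 / √E := by positivity
        have q3 : (√E * p - q) ^ 2 / √E = √E * p ^ 2 + q ^ 2 / √E - 2 * (p * q) := by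
          field_simp; ring
        linarith
      linarith
  have hval : ∫ x in fund (n+1) L γ, 2 * r * (‖Ψ x‖ ^ 2 / L + (√E * ‖Ψ x‖ ^ 2 + ‖fderiv ℝ Ψ x v‖ ^ 2 / √E))
      ≤ 2 * r * (1 / L + 2 * √E) := by
    rw [integral_const_mul, integral_add (hΨi.div_const _) (fund_integrableOn L γ _ hkc),
      integral_add (hΨi.const_mul _) (hDi.div_const _), integral_div, integral_div, integral_const_mul, h4]
    have : (∫ x in fund (n+1) L γ, ‖fderiv ℝ Ψ x v‖ ^ 2) / √E ≤ √E := by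
      rw [div_le_iff₀ hsE, Real.mul_self_sqrt hE.le]; exact hen
    gcongr
    linarith
  linarith

/-- **Blow-up of localization length for exponential decay** (Section 2.2.1): with the
absolute constants and energy conditions of the algebraic delocalization theorem, if
`∫_{𝕋^d_L ∖ B(x₀,r)} |Ψ|² dμ ≤ C e^{-βr}` for all `r ≥ ℓ_loc := log(2C)/β`
(`C > 1/2`, `β > 0`), and `E < C`, then
`ℓ_loc > c_V E^{-1/4+η(1-d/4)} · min(1, log(2C) E^{-η}/log(C/E))`. -/
theorem localization_length_lower_bound_exponential :
    ∃ c₁ c₂ : ℝ, 0 < c₁ ∧ 0 < c₂ ∧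
      ∀ (d : ℕ) (hd : 0 < d), d ≤ 3 →
      ∀ γ : Fin d → ℝ, (∀ i, 1 ≤ γ i) → γ ⟨0, hd⟩ = 1 →
      ∀ η : ℝ, 0 < η → η < 1 / (4 - (d : ℝ)) →
      ∀ Vsup : ℝ, 0 ≤ Vsup →
      ∀ cV : ℝ, cV = c₁ * (1 + Vsup ^ ((1:ℝ)/2)) ^ (-(1:ℝ)/2) →
      ∃ L₀ : ℝ, 0 < L₀ ∧ ∀ L : ℝ, L₀ ≤ L →
      ∀ V : EuclideanSpace ℝ (Fin d) → ℝ,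
        Measurable V → (∀ x, 0 ≤ V x) → (∀ x, V x ≤ Vsup) → LatPeriodic d L γ V →
      ∀ E : ℝ, 0 < E → E < 1 →
        (2 * cV / L) ^ ((4:ℝ) / (1 + d * η)) ≤ E →
        E ≤ min (cV ^ ((4:ℝ) / (1 + d * η))) (c₂ ^ ((2:ℝ) / (d * η))) →
      ∀ Ψ : EuclideanSpace ℝ (Fin d) → ℂ, IsSolution d L γ V E Ψ →
      ∀ (x₀ : EuclideanSpace ℝ (Fin d)) (C β : ℝ), 1 / 2 < C → 0 < β →
        (∀ r, Real.log (2 * C) / β ≤ r →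
          (∫ x in fund d L γ \ torusBall d L γ x₀ r, ‖Ψ x‖ ^ 2) ≤ C * Real.exp (-β * r)) →
        E < C →
        Real.log (2 * C) / β >
          cV * E ^ (-(1:ℝ)/4 + η * (1 - (d:ℝ)/4)) *
            min 1 (Real.log (2 * C) * E ^ (-η) / Real.log (C / E)) := by
  refine ⟨1/64, 1/64, by norm_num, by norm_num, ?_⟩
  intro d hd hd3 γ hγ hγ0 η hη hη2 Vsup hVs cV hcV
  refine ⟨1, one_pos, ?_⟩
  intro L hL1 V _ hV0 _ _ E hE hE1 hElow hEup Ψ hΨ x₀ C β hC hβ hloc _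
  have hL : 0 < L := by linarith
  by_contra hcon
  have hcon := not_lt.1 hcon
  set r := cV * E ^ (-(1:ℝ)/4 + η * (1 - (d:ℝ)/4)) with hr
  have hbase : 1 ≤ 1 + Vsup ^ ((1:ℝ)/2) := by
    have := Real.rpow_nonneg hVs ((1:ℝ)/2); linarith
  have hcVpos : 0 < cV := by rw [hcV]; positivity
  have hcVle : cV ≤ 1/64 := by
    have := Real.rpow_le_one_of_one_le_of_nonpos hbase (by norm_num : -(1:ℝ)/2 ≤ 0)
    rw [hcV]; linarith
  have hrpos : 0 < r := by positivity
  have hd' : (1:ℝ) ≤ d := by exact_mod_cast hd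
  have hd3' : (d:ℝ) ≤ 3 := by exact_mod_cast hd3
  have hler : Real.log (2 * C) / β ≤ r := by
    refine hcon.trans ?_
    calc _ ≤ r * 1 := by gcongr; exact min_le_left _ _
      _ = r := mul_one r
  have hmass := hloc r hler
  have hhalf : C * Real.exp (-β * r) ≤ 1 / 2 := by
    have h1 : Real.log (2 * C) ≤ r * β := by rwa [div_le_iff₀ hβ] at hler
    have h2 : Real.exp (-β * r) ≤ Real.exp (-Real.log (2 * C)) := Real.exp_le_exp.2 (by linarith)
    rw [Real.exp_neg, Real.exp_log (by linarith)] at h2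
    calc C * Real.exp (-β * r) ≤ C * (2 * C)⁻¹ := by gcongr
      _ = 1 / 2 := by field_simp
  have hdη : 0 < (d:ℝ) * η := by positivity
  -- E ^ η ≤ 1/16
  have hEη : E ^ η ≤ 1 / 16 := by
    have h1 : E ≤ (1/64 : ℝ) ^ ((2:ℝ) / (d * η)) := hEup.trans (min_le_right _ _)
    have h2 : E ^ ((d * η) / 2) ≤ 1 / 64 := by
      calc E ^ ((d * η) / 2) ≤ ((1/64 : ℝ) ^ ((2:ℝ) / (d * η))) ^ ((d * η) / 2) := by gcongr
        _ = 1 / 64 := by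
          rw [← Real.rpow_mul (by norm_num)]
          rw [show (2:ℝ) / (d * η) * ((d * η) / 2) = 1 by field_simp, Real.rpow_one]
    have h3 : E ^ (η * (3 / 2)) ≤ E ^ ((d * η) / 2) :=
      Real.rpow_le_rpow_of_exponent_ge hE hE1.le (by nlinarith)
    have h4 : (E ^ (η / 2)) ^ 3 ≤ 1 / 64 := by
      rw [← Real.rpow_natCast, ← Real.rpow_mul hE.le]
      refine le_trans (le_of_eq ?_) (h3.trans h2)
      congr 1; push_cast; ring
    have h5 : E ^ (η / 2) ≤ 1 / 4 := by
      refine le_of_pow_le_pow_left₀ (n := 3) (by norm_num) (by norm_num) (h4.trans (by norm_num))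
    have h6 : E ^ η = E ^ (η / 2) * E ^ (η / 2) := by
      rw [← Real.rpow_add hE]; congr 1; ring
    have h7 : 0 ≤ E ^ (η / 2) := by positivity
    rw [h6]; nlinarith
  have hrL : 2 * r * (1 / L) ≤ 1 / 16 := by
    have h1 : 2 * cV / L ≤ E ^ ((1 + d * η) / 4) := by
      calc 2 * cV / L = ((2 * cV / L) ^ ((4:ℝ) / (1 + d * η))) ^ ((1 + d * η) / 4) := by
            rw [← Real.rpow_mul (by positivity)]
            rw [show (4:ℝ) / (1 + d * η) * ((1 + d * η) / 4) = 1 by field_simp, Real.rpow_one]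
        _ ≤ _ := by gcongr
    calc 2 * r * (1 / L) = (2 * cV / L) * E ^ (-(1:ℝ)/4 + η * (1 - (d:ℝ)/4)) := by rw [hr]; ring
      _ ≤ E ^ ((1 + d * η) / 4) * E ^ (-(1:ℝ)/4 + η * (1 - (d:ℝ)/4)) := by gcongr
      _ = E ^ η := by rw [← Real.rpow_add hE]; congr 1; ring
      _ ≤ 1 / 16 := hEη
  have hrE : r * √E ≤ 1 / 64 := by
    calc r * √E = cV * E ^ ((1:ℝ)/4 + η * (1 - (d:ℝ)/4)) := by
          rw [hr, Real.sqrt_eq_rpow, mul_assoc, ← Real.rpow_add hE]; congr 2; ring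
      _ ≤ cV * 1 := by
          gcongr
          refine Real.rpow_le_one hE.le hE1.le ?_
          have : 0 ≤ η * (1 - (d:ℝ)/4) := mul_nonneg hη.le (by linarith)
          linarith
      _ ≤ 1 / 64 := by linarith
  obtain ⟨n, rfl⟩ : ∃ n, d = n + 1 := ⟨d - 1, by omega⟩
  have hfin := slab_mass L hL γ hγ hγ0 V hV0 E hE Ψ hΨ x₀ r hrpos.le
  nlinarith
end
end

section
/- There is an absolute constant c > 0 such that the following holds. Let d ≤ 3, let Ψ_λ be finitely many L²-orthonormal C² solutions of (−Δ+V)Ψ_λ = λΨ_λ on 𝕋^d_L with eigenvalues λ ∈ [E,2E], 0 < E < 1, let h : ℝ → ℝ be continuous with support in [E,2E] and ‖h‖_∞ ≤ 1, fix x₀' ∈ 𝕋^d_L with N := Σ_λ h(λ)²|Ψ_λ(x₀')|² ≠ 0, and set F = N^{−1/2} Σ_λ h(λ) conj(Ψ_λ(x₀')) Ψ_λ, so ‖F‖_{L²} = 1. Let x₀ ∈ 𝕋^d_L and 1 ≤ r ≤ L/2, and suppose ∫_{𝕋^d_L ∖ B(x₀,r)} |F|² dμ ≤ E. Then for all x₁,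 x₂ ∈ B(x₀,r): |F(x₁) − F(x₂)| ≤ c · r^{(4−d)/2} · (1 + ‖V‖_∞) · E^{1/2}. -/
open MeasureTheory Real Filter

noncomputable section

def HH (x : ℝ) : ℝ := 1 / ((x ^ ((1:ℝ)/3)) ^ 2 * (1 + x ^ ((1:ℝ)/3)) ^ 2)

lemma HH_nonneg (x : ℝ) : 0 ≤ HH x := by unfold HH; positivity

lemma cbrt_pow (x : ℝ) (hx : 0 ≤ x) : (x ^ ((1:ℝ)/3)) ^ 3 = x := by
  rw [← Real.rpow_natCast, ← Real.rpow_mul hx]; norm_num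

lemma D0 {a u v : ℝ} (hu : 0 < u) (hv : 0 ≤ v) (ha : 0 < a) (h : u ^ 3 - v ^ 3 = a) :
    a * (1 / (u ^ 2 * (1 + u) ^ 2)) ≤ 3 * (u / (1 + u) - v / (1 + v)) := by
  have huv : v < u := by
    by_contra hc
    push Not at hc
    have := pow_le_pow_left₀ hu.le hc 3
    linarith
  have e : u / (1 + u) - v / (1 + v) = (u - v) / ((1 + u) * (1 + v)) := by
    field_simp; ring
  have h1 : (u - v) / (1 + u) ^ 2 ≤ (u - v) / ((1 + u) * (1 + v)) := by
    apply div_le_div_of_nonneg_left (by linarith) (by positivity)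
    nlinarith
  have h2 : a ≤ 3 * u ^ 2 * (u - v) := by
    rw [← h]
    nlinarith [mul_nonneg (sub_nonneg.2 huv.le) (mul_nonneg hu.le (sub_nonneg.2 huv.le)), mul_nonneg (sub_nonneg.2 huv.le) (mul_nonneg hv (sub_nonneg.2 huv.le))]
  have h3 : a * (1 / (u ^ 2 * (1 + u) ^ 2)) ≤ 3 * ((u - v) / (1 + u) ^ 2) := by
    rw [mul_one_div, ← mul_div_assoc, div_le_div_iff₀ (by positivity) (by positivity)]
    have := mul_le_mul_of_nonneg_right h2 (sq_nonneg (1 + u))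
    nlinarith
  rw [e]; linarith

lemma D1 (P : ℝ) (hP : 0 < P) (M : ℕ) :
    ∑ m ∈ Finset.range M, (1 / P) * HH (((m : ℝ) + 1) / P) ≤ 3 := by
  have key : ∀ M : ℕ, ∑ m ∈ Finset.range M, (1 / P) * HH (((m : ℝ) + 1) / P) ≤
      3 * (((M : ℝ) / P) ^ ((1:ℝ)/3) / (1 + ((M : ℝ) / P) ^ ((1:ℝ)/3))) := by
    intro M
    induction M with
    | zero => simp
    | succ M ih =>
      rw [Finset.sum_range_succ]
      have := D0 (a := 1 / P) (u := (((M : ℝ) + 1) / P) ^ ((1:ℝ)/3))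
        (v := ((M : ℝ) / P) ^ ((1:ℝ)/3)) (by positivity) (by positivity) (by positivity)
        (by rw [cbrt_pow _ (by positivity), cbrt_pow _ (by positivity)]; field_simp; ring)
      unfold HH at ih ⊢
      push_cast
      linarith
  refine (key M).trans ?_
  have : 0 ≤ ((M : ℝ) / P) ^ ((1:ℝ)/3) := by positivity
  have : ((M : ℝ) / P) ^ ((1:ℝ)/3) / (1 + ((M : ℝ) / P) ^ ((1:ℝ)/3)) ≤ 1 := by
    rw [div_le_one (by positivity)]; linarith
  linarith

lemma D2 (P : ℝ) (hP : 0 < P) (s : Finset ℤ) :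
    ∑ k ∈ s, (1 / P) * HH (max 1 |(k : ℝ)| / P) ≤ 12 := by
  have hn : ∀ x, 0 ≤ (1 / P) * HH x := fun x => mul_nonneg (by positivity) (HH_nonneg _)
  set M := ∑ k ∈ s, k.natAbs
  have hM : ∀ k ∈ s, k.natAbs ≤ M := fun k hk =>
    Finset.single_le_sum (f := fun k : ℤ => k.natAbs) (fun _ _ => Nat.zero_le _) hk
  have hb : ∑ m ∈ Finset.range (M + 1), (1 / P) * HH (max 1 |((m : ℕ) : ℝ)| / P) ≤ 6 := by
    rw [Finset.sum_range_succ']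
    have h1 := D1 P hP M
    have h2 := D1 P hP 1
    simp only [Finset.sum_range_one, Nat.cast_zero, zero_add] at h2
    have : ∀ m : ℕ, max 1 |((m + 1 : ℕ) : ℝ)| = (m : ℝ) + 1 := by
      intro m
      rw [abs_of_nonneg (by positivity), max_eq_right]
      · push_cast; rfl
      · push_cast; linarith [(Nat.cast_nonneg m : (0:ℝ) ≤ m)]
    simp only [this]
    simp only [Nat.cast_zero, abs_zero, max_eq_left zero_le_one]
    linarith
  have hsub : s ⊆ (Finset.range (M + 1)).image (fun m : ℕ => (m : ℤ)) ∪
      (Finset.range (M + 1)).image (fun m : ℕ => -(m : ℤ)) := by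
    intro k hk
    have := hM k hk
    simp only [Finset.mem_union, Finset.mem_image, Finset.mem_range]
    rcases le_total 0 k with h | h
    · left; exact ⟨k.natAbs, by omega, by omega⟩
    · right; exact ⟨k.natAbs, by omega, by omega⟩
  refine (Finset.sum_le_sum_of_subset_of_nonneg hsub (fun _ _ _ => hn _)).trans ?_
  have hu := Finset.sum_union_inter (s₁ := (Finset.range (M + 1)).image (fun m : ℕ => (m : ℤ)))
    (s₂ := (Finset.range (M + 1)).image (fun m : ℕ => -(m : ℤ)))
    (f := fun k : ℤ => (1 / P) * HH (max 1 |(k : ℝ)| / P))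
  have hi := Finset.sum_nonneg (s := ((Finset.range (M + 1)).image (fun m : ℕ => (m : ℤ))) ∩
      (Finset.range (M + 1)).image (fun m : ℕ => -(m : ℤ)))
    (f := fun k : ℤ => (1 / P) * HH (max 1 |(k : ℝ)| / P)) (fun _ _ => hn _)
  rw [Finset.sum_image (fun a _ b _ h => by simpa using h),
    Finset.sum_image (fun a _ b _ h => by simpa using h)] at hu
  simp only [Int.cast_neg, abs_neg, Int.cast_natCast] at hu
  linarith

lemma D3a (u : ℝ) (hu : 0 ≤ u) : u ^ 2 * (1 + u) ^ 2 ≤ 4 * (1 + u ^ 6) := by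
  nlinarith [sq_nonneg (u-1), sq_nonneg (u^2-1), sq_nonneg (u^3-1), sq_nonneg (u^3-u), mul_nonneg hu (sq_nonneg (u-1)),mul_nonneg (mul_nonneg hu hu) (sq_nonneg (u-1)), pow_nonneg hu 6, mul_nonneg (sq_nonneg u) (sq_nonneg (u^2-1))]

lemma D3b (u : ℝ) (hu : 0 ≤ u) : (u ^ 2 * (1 + u) ^ 2) ^ 3 ≤ 32 * (2 * u ^ 6 + (u ^ 6) ^ 2) := by
  have h : (1 + u) ^ 6 ≤ 2 ^ 5 * (1 ^ 6 + u ^ 6) := add_pow_le (by norm_num) hu 6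
  have h6 : 0 ≤ u ^ 6 := by positivity
  calc (u ^ 2 * (1 + u) ^ 2) ^ 3 = u ^ 6 * (1 + u) ^ 6 := by ring
    _ ≤ u ^ 6 * (2 ^ 5 * (1 ^ 6 + u ^ 6)) := by gcongr
    _ ≤ _ := by nlinarith

lemma D3 (d : ℕ) (hd : 0 < d) (hd3 : d ≤ 3) (ρ : ℝ) (hρ : 1 ≤ ρ) (u : Fin d → ℝ)
    (hu : ∀ i, 0 ≤ u i) :
    ∏ i, (u i ^ 2 * (1 + u i) ^ 2) ≤ 32 * ρ ^ (4 - d) * (1 / ρ + ∑ i, u i ^ 6) ^ 2 := by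
  have hρ0 : 0 < ρ := by linarith
  set y := ∑ i, u i ^ 6 with hy
  have hyi : ∀ i, u i ^ 6 ≤ y := fun i =>
    Finset.single_le_sum (f := fun i => u i ^ 6) (fun j _ => by have := hu j; positivity) (Finset.mem_univ i)
  have hy0 : 0 ≤ y := Finset.sum_nonneg (fun j _ => by have := hu j; positivity)
  have e1 : ρ * (1 / ρ + y) = 1 + ρ * y := by field_simp
  have e2 : 1 + y ≤ ρ * (1 / ρ + y) := by rw [e1]; nlinarith
  have q0 : ∀ i, 0 ≤ u i ^ 2 * (1 + u i) ^ 2 := fun i => by positivity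
  have q1 : ∀ i, u i ^ 2 * (1 + u i) ^ 2 ≤ 4 * (ρ * (1 / ρ + y)) := fun i => by
    have := D3a (u i) (hu i); have := hyi i; linarith
  have q2 : ∀ i, (u i ^ 2 * (1 + u i) ^ 2) ^ 3 ≤ 32 * (ρ * (1 / ρ + y) ^ 2) := fun i => by
    refine (D3b (u i) (hu i)).trans ?_
    have e3 : ρ * (1 / ρ + y) ^ 2 = 1 / ρ + 2 * y + ρ * y ^ 2 := by field_simp; ring
    have h6 : 0 ≤ u i ^ 6 := by have := hu i; positivity
    have := hyi i
    have h7 : (u i ^ 6) ^ 2 ≤ y ^ 2 := pow_le_pow_left₀ h6 this 2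
    have h8 : 0 ≤ 1 / ρ := by positivity
    have h9 : y ^ 2 ≤ ρ * y ^ 2 := by nlinarith [sq_nonneg y]
    rw [e3]; linarith
  set B := ρ * (1 / ρ + y) with hB
  clear_value B y
  obtain rfl | rfl | rfl : d = 1 ∨ d = 2 ∨ d = 3 := by omega
  · simp only [Fin.prod_univ_one]
    have e : ρ ^ (4 - 1) * (1 / ρ + y) ^ 2 = ρ * B ^ 2 := by rw [hB]; norm_num; ring
    rw [mul_assoc 32, e]
    have := q1 0
    have hB1 : 1 ≤ B := by linarith
    nlinarith [mul_nonneg (sub_nonneg.2 hρ) (sq_nonneg B)]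
  · simp only [Fin.prod_univ_two]
    have e : ρ ^ (4 - 2) * (1 / ρ + y) ^ 2 = B ^ 2 := by rw [hB]; norm_num; ring
    rw [mul_assoc 32, e]
    have := mul_le_mul (q1 0) (q1 1) (q0 1) (by linarith)
    nlinarith [sq_nonneg B]
  · have e : ρ ^ (4 - 3) * (1 / ρ + y) ^ 2 = ρ * (1 / ρ + y) ^ 2 := by norm_num
    rw [mul_assoc 32, e]
    refine le_of_pow_le_pow_left₀ (n := 3) (by norm_num) (by positivity) ?_
    rw [← Finset.prod_pow]
    refine (Finset.prod_le_prod (fun i _ => by have := q0 i; positivity) (fun i _ => q2 i)).trans ?_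
    simp

lemma lattice_sum (d : ℕ) (hd : 0 < d) (hd3 : d ≤ 3) (ρ : ℝ) (hρ : 1 ≤ ρ) (P : Fin d → ℝ)
    (hP : ∀ i, ρ ≤ P i) (s : Finset (Fin d → ℤ)) :
    ∑ k ∈ s, 1 / (1 / ρ + ∑ i, (2 * π * (k i : ℝ) / P i) ^ 2) ^ 2 ≤
      (∏ i, P i) * (16 * 32 * 12 ^ 3 * ρ ^ (4 - d)) := by
  have hρ0 : 0 < ρ := by linarith
  have hP0 : ∀ i, 0 < P i := fun i => hρ0.trans_le (hP i)
  have step : ∀ k : Fin d → ℤ, 1 / (1 / ρ + ∑ i, (2 * π * (k i : ℝ) / P i) ^ 2) ^ 2 ≤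
      16 * 32 * ρ ^ (4 - d) * ∏ i, HH (max 1 |(k i : ℝ)| / P i) := by
    intro k
    set x : Fin d → ℝ := fun i => max 1 |(k i : ℝ)| / P i with hx
    have hx0 : ∀ i, 0 < x i := fun i => div_pos (lt_of_lt_of_le one_pos (le_max_left _ _)) (hP0 i)
    have hsq : ∀ i, x i ^ 2 ≤ (2 * π * (k i : ℝ) / P i) ^ 2 + 1 / ρ := by
      intro i
      have h1 : (1 / P i) ^ 2 ≤ 1 / ρ := by
        have : 1 / P i ≤ 1 / ρ := one_div_le_one_div_of_le hρ0 (hP i)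
        have h0 : 0 < 1 / P i := one_div_pos.2 (hP0 i)
        have h11 : 1 / ρ ≤ 1 := by rw [div_le_one hρ0]; exact hρ
        nlinarith
      have h2 : (max 1 |(k i : ℝ)|) ^ 2 ≤ 1 + (2 * π * (k i : ℝ)) ^ 2 := by
        have hpi := Real.pi_gt_three
        have : (1:ℝ) ≤ (2 * π) ^ 2 := by nlinarith
        rcases max_cases 1 |(k i : ℝ)| with h | h
        · rw [h.1]; nlinarith [sq_nonneg (2 * π * (k i : ℝ))]
        · rw [h.1, sq_abs, mul_pow]; nlinarith [sq_nonneg (k i : ℝ)]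
      calc x i ^ 2 = (max 1 |(k i : ℝ)|) ^ 2 * (1 / P i) ^ 2 := by simp only [hx]; ring
        _ ≤ (1 + (2 * π * (k i : ℝ)) ^ 2) * (1 / P i) ^ 2 := by gcongr
        _ = (1 / P i) ^ 2 + (2 * π * (k i : ℝ) / P i) ^ 2 := by ring
        _ ≤ _ := by linarith
    have hsum : ∑ i, x i ^ 2 ≤ ∑ i, (2 * π * (k i : ℝ) / P i) ^ 2 + 3 * (1 / ρ) := by
      refine (Finset.sum_le_sum (fun i _ => hsq i)).trans ?_
      rw [Finset.sum_add_distrib]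
      simp only [Finset.sum_const, Finset.card_univ, Fintype.card_fin, nsmul_eq_mul]
      have : (d : ℝ) ≤ 3 := by exact_mod_cast hd3
      have : 0 ≤ 1 / ρ := by positivity
      gcongr
    have hw0 : 0 ≤ ∑ i, (2 * π * (k i : ℝ) / P i) ^ 2 := Finset.sum_nonneg (fun _ _ => sq_nonneg _)
    set w := ∑ i, (2 * π * (k i : ℝ) / P i) ^ 2
    have h1ρ : 0 < 1 / ρ := by positivity
    have h3 := D3 d hd hd3 ρ hρ (fun i => x i ^ ((1:ℝ)/3)) (fun i => by have := hx0 i; positivity)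
    have h6 : ∀ i, (x i ^ ((1:ℝ)/3)) ^ 6 = x i ^ 2 := fun i => by
      rw [show (6:ℕ) = 3 * 2 by norm_num, pow_mul, cbrt_pow _ (hx0 i).le]
    simp only [h6] at h3
    have h4 : (1 / ρ + ∑ i, x i ^ 2) ^ 2 ≤ 16 * (1 / ρ + w) ^ 2 := by
      have h0 : 0 ≤ ∑ i, x i ^ 2 := Finset.sum_nonneg (fun _ _ => sq_nonneg _)
      calc (1 / ρ + ∑ i, x i ^ 2) ^ 2 ≤ (4 * (1 / ρ + w)) ^ 2 := by
            apply pow_le_pow_left₀ (by positivity); linarith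
        _ = _ := by ring
    have hpos : 0 < ∏ i, ((x i ^ ((1:ℝ)/3)) ^ 2 * (1 + x i ^ ((1:ℝ)/3)) ^ 2) :=
      Finset.prod_pos (fun i _ => by have := hx0 i; positivity)
    have hH : ∏ i, HH (x i) = 1 / ∏ i, ((x i ^ ((1:ℝ)/3)) ^ 2 * (1 + x i ^ ((1:ℝ)/3)) ^ 2) := by
      simp only [HH, one_div, Finset.prod_inv_distrib]
    rw [hH, mul_one_div, div_le_div_iff₀ (by positivity) hpos, one_mul]
    refine h3.trans ?_
    calc 32 * ρ ^ (4 - d) * (1 / ρ + ∑ i, x i ^ 2) ^ 2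
        ≤ 32 * ρ ^ (4 - d) * (16 * (1 / ρ + w) ^ 2) := by gcongr
      _ = _ := by ring
  refine (Finset.sum_le_sum (fun k _ => step k)).trans ?_
  rw [← Finset.mul_sum]
  have hfin : ∑ k ∈ s, ∏ i, HH (max 1 |(k i : ℝ)| / P i) ≤ (∏ i, P i) * 12 ^ 3 := by
    set t : Fin d → Finset ℤ := fun i => s.image (fun k => k i)
    have hsub : s ⊆ Fintype.piFinset t := by
      intro k hk
      rw [Fintype.mem_piFinset]
      exact fun i => Finset.mem_image_of_mem _ hk
    refine (Finset.sum_le_sum_of_subset_of_nonneg hsub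
      (fun _ _ _ => Finset.prod_nonneg (fun _ _ => HH_nonneg _))).trans ?_
    rw [← Finset.prod_univ_sum t (fun i k => HH (max 1 |(k : ℝ)| / P i))]
    have : ∀ i, ∑ k ∈ t i, HH (max 1 |(k : ℝ)| / P i) ≤ P i * 12 := by
      intro i
      have := D2 (P i) (hP0 i) (t i)
      rw [← Finset.mul_sum, one_div, inv_mul_le_iff₀ (hP0 i)] at this
      exact this
    refine (Finset.prod_le_prod (fun i _ => Finset.sum_nonneg (fun _ _ => HH_nonneg _)) (fun i _ => this i)).trans ?_
    rw [Finset.prod_mul_distrib]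
    have hpp : 0 ≤ ∏ i, P i := Finset.prod_nonneg (fun i _ => (hP0 i).le)
    simp only [Finset.prod_const, Finset.card_univ, Fintype.card_fin]
    gcongr
    norm_num
  calc 16 * 32 * ρ ^ (4 - d) * ∑ k ∈ s, ∏ i, HH (max 1 |(k i : ℝ)| / P i)
      ≤ 16 * 32 * ρ ^ (4 - d) * ((∏ i, P i) * 12 ^ 3) := by gcongr
    _ = _ := by ring


local instance : MeasureSpace UnitAddCircle := ⟨AddCircle.haarAddCircle⟩
local instance : Measure.IsAddHaarMeasure (volume : Measure UnitAddCircle) :=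
  inferInstanceAs (Measure.IsAddHaarMeasure AddCircle.haarAddCircle)
local instance : IsProbabilityMeasure (volume : Measure UnitAddCircle) :=
  inferInstanceAs (IsProbabilityMeasure AddCircle.haarAddCircle)

open UnitAddTorus

def box (d : ℕ) : Set (Fin d → ℝ) := {x | ∀ i, x i ∈ Set.Ioc ((fun _ => (0:ℝ)) i : ℝ) ((fun _ => (0:ℝ)) i + 1)}

lemma fourier_parseval {d : ℕ} (f g : C(UnitAddTorus (Fin d), ℂ)) :
    HasSum (fun k => (starRingEnd ℂ) (mFourierCoeff f k) * mFourierCoeff g k)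
      (∫ x in box d, (starRingEnd ℂ) (f (fun i => (x i : UnitAddCircle))) *
        g (fun i => (x i : UnitAddCircle))) := by
  have h := hasSum_prod_mFourierCoeff (f.toLp 2 volume ℂ) (g.toLp 2 volume ℂ)
  simp only [mFourierCoeff_toLp] at h
  have e : (∫ t, (starRingEnd ℂ) ((f.toLp 2 volume ℂ : Lp ℂ 2 (volume : Measure (UnitAddTorus (Fin d)))) t) * (g.toLp 2 volume ℂ : Lp ℂ 2 (volume : Measure (UnitAddTorus (Fin d)))) t) =
     ∫ t, (starRingEnd ℂ) (f t) * g t := by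
    apply integral_congr_ae
    filter_upwards [f.coeFn_toLp (p := 2) (𝕜 := ℂ) volume, g.coeFn_toLp (p := 2) (𝕜 := ℂ) volume] with t h1 h2
    rw [h1, h2]
  rw [e] at h
  rw [integral_preimage _ (fun _ => 0)] at h
  exact h

lemma fourier_main {d : ℕ} (f g : C(UnitAddTorus (Fin d), ℂ)) (w : (Fin d → ℤ) → ℝ)
    (hw : ∀ k, 0 ≤ w k) (hc : ∀ k, mFourierCoeff g k = (w k : ℂ) * mFourierCoeff f k)
    (A B : ℝ) (hA : A = (∫ x in box d, (starRingEnd ℂ) (f (fun i => (x i : UnitAddCircle))) *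
        g (fun i => (x i : UnitAddCircle))).re)
    (hB : B = (∫ x in box d, (starRingEnd ℂ) (g (fun i => (x i : UnitAddCircle))) *
        g (fun i => (x i : UnitAddCircle))).re)  :
    0 ≤ A ∧ ∀ ρ : ℝ, 1 ≤ ρ → ∀ S : ℝ, (∀ s : Finset (Fin d → ℤ), ∑ k ∈ s, 1 / (1 / ρ + w k) ^ 2 ≤ S) →
      ∀ y z : UnitAddTorus (Fin d), (∀ k, ‖mFourier k y - mFourier k z‖ ^ 2 ≤ ρ ^ 2 * w k) →
      ‖f y - f z‖ ^ 2 ≤ 8 * (A + B) * S := by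
  have h1 : HasSum (fun k => w k * ‖mFourierCoeff f k‖ ^ 2) A := by
    have := Complex.hasSum_re (fourier_parseval f g)
    rw [← hA] at this
    refine this.congr_fun ?_
    intro k
    rw [hc, mul_left_comm, ← Complex.normSq_eq_conj_mul_self, ← Complex.ofReal_mul,
      Complex.ofReal_re, Complex.normSq_eq_norm_sq]
  have h2 : HasSum (fun k => w k ^ 2 * ‖mFourierCoeff f k‖ ^ 2) B := by
    have := Complex.hasSum_re (fourier_parseval g g)
    rw [← hB] at this
    refine this.congr_fun ?_
    intro k
    rw [← Complex.normSq_eq_conj_mul_self,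
      Complex.ofReal_re, Complex.normSq_eq_norm_sq, hc, norm_mul, mul_pow, Complex.norm_real,
      Real.norm_eq_abs, sq_abs]
  have h0 : Summable (fun k => ‖mFourierCoeff f k‖ ^ 2) := by
    have := (Complex.hasSum_re (fourier_parseval f f)).summable
    refine this.congr ?_
    intro k
    rw [← Complex.normSq_eq_conj_mul_self,
      Complex.ofReal_re, Complex.normSq_eq_norm_sq]
  refine ⟨h1.nonneg (fun k => mul_nonneg (hw k) (by positivity)), ?_⟩
  intro ρ hρ S hS y z hyz
  have hρ0 : 0 < ρ := by linarith
  have hinv : 0 < 1 / ρ := by positivity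
  have hsumS : Summable (fun k => 1 / (1 / ρ + w k) ^ 2) :=
    summable_of_sum_le (fun k => by positivity) hS
  have hS0 : 0 ≤ S := by simpa using hS ∅
  -- summability of coefficients
  have hsa : Summable (mFourierCoeff f) := by
    apply Summable.of_norm
    have hq := ((h0.add h2.summable).mul_left 2).add hsumS
    refine Summable.of_nonneg_of_le (fun _ => norm_nonneg _) (fun k => ?_) hq
    set a := ‖mFourierCoeff f k‖
    have hwk := hw k
    have hp : 0 < 1 / ρ + w k := by linarith
    have hle : (1 / ρ + w k) ^ 2 ≤ 2 * (1 + w k ^ 2) := by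
      have : 1 / ρ ≤ 1 := by rw [div_le_one hρ0]; exact hρ
      nlinarith [sq_nonneg (1 - w k)]
    set q := 1 / ρ + w k
    have ha : 0 ≤ a := norm_nonneg _
    have hq1 : q * (1 / q) = 1 := by field_simp
    have : 1 / q ^ 2 = (1 / q) ^ 2 := by ring
    rw [this]
    have e : a = (a * q) * (1 / q) := by field_simp
    have e2 : (a * q) ^ 2 ≤ 2 * (a ^ 2 + w k ^ 2 * a ^ 2) := by
      rw [mul_pow]; nlinarith [sq_nonneg a]
    nlinarith [sq_nonneg (a * q - 1 / q), sq_nonneg (a * q), sq_nonneg (1 / q)]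
  have hfy := hasSum_mFourier_series_apply_of_summable hsa y
  have hfz := hasSum_mFourier_series_apply_of_summable hsa z
  have hd := hfy.sub hfz
  -- bound finite sums
  have hfin : ∀ s : Finset (Fin d → ℤ),
      ‖∑ k ∈ s, (mFourierCoeff f k • mFourier k y - mFourierCoeff f k • mFourier k z)‖ ^ 2
        ≤ 8 * (A + B) * S := by
    intro s
    have t1 : ‖∑ k ∈ s, (mFourierCoeff f k • mFourier k y - mFourierCoeff f k • mFourier k z)‖ ≤
        ∑ k ∈ s, (‖mFourierCoeff f k‖ * ‖mFourier k y - mFourier k z‖ * (1 / ρ + w k)) * (1 / (1 / ρ + w k)) := by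
      refine (norm_sum_le _ _).trans (le_of_eq (Finset.sum_congr rfl fun k _ => ?_))
      have : 0 < 1 / ρ + w k := by linarith [hw k]
      rw [← smul_sub, norm_smul, mul_assoc _ _ (1 / (1 / ρ + w k)), mul_one_div_cancel this.ne', mul_one]
    have t2 := Finset.sum_mul_sq_le_sq_mul_sq s
      (fun k => ‖mFourierCoeff f k‖ * ‖mFourier k y - mFourier k z‖ * (1 / ρ + w k)) (fun k => 1 / (1 / ρ + w k))
    have t3 : ∑ k ∈ s, (‖mFourierCoeff f k‖ * ‖mFourier k y - mFourier k z‖ * (1 / ρ + w k)) ^ 2 ≤ 8 * (A + B) := by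
      have hle := sum_le_hasSum s (fun k _ => by have := hw k; positivity) ((h1.add h2).mul_left 8)
      refine le_trans (Finset.sum_le_sum fun k _ => ?_) hle
      have hm : ‖mFourier k y - mFourier k z‖ ^ 2 ≤ 4 := by
        have n1 := (mFourier k).norm_coe_le_norm y
        have n2 := (mFourier k).norm_coe_le_norm z
        rw [mFourier_norm] at n1 n2
        have := norm_sub_le (mFourier k y) (mFourier k z)
        nlinarith [norm_nonneg (mFourier k y - mFourier k z)]
      have hm2 := hyz k
      have hwk := hw k
      set m2 := ‖mFourier k y - mFourier k z‖ ^ 2 with hm2d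
      have hm0 : 0 ≤ m2 := sq_nonneg _
      have key : m2 * (1 / ρ + w k) ^ 2 ≤ 8 * (w k + w k ^ 2) := by
        have r1 : (1 / ρ + w k) ^ 2 ≤ 2 * (1 / ρ) ^ 2 + 2 * w k ^ 2 := by
          nlinarith [sq_nonneg (1 / ρ - w k)]
        have r2 : m2 * (1 / ρ) ^ 2 ≤ w k := by
          calc m2 * (1 / ρ) ^ 2 ≤ ρ ^ 2 * w k * (1 / ρ) ^ 2 := by gcongr
            _ = w k := by field_simp
        have r3 : m2 * w k ^ 2 ≤ 4 * w k ^ 2 := by gcongr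
        nlinarith [mul_le_mul_of_nonneg_left r1 hm0]
      rw [mul_pow, mul_pow, ← hm2d]
      nlinarith [mul_le_mul_of_nonneg_left key (sq_nonneg ‖mFourierCoeff f k‖)]
    have t4 : ∑ k ∈ s, (1 / (1 / ρ + w k)) ^ 2 ≤ S := by
      simpa only [one_div_pow] using hS s
    have t40 : 0 ≤ ∑ k ∈ s, (1 / (1 / ρ + w k)) ^ 2 := Finset.sum_nonneg fun _ _ => sq_nonneg _
    have t30 : 0 ≤ ∑ k ∈ s, (‖mFourierCoeff f k‖ * ‖mFourier k y - mFourier k z‖ * (1 / ρ + w k)) ^ 2 := Finset.sum_nonneg fun _ _ => sq_nonneg _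
    calc _ ≤ _ := pow_le_pow_left₀ (norm_nonneg _) t1 2
      _ ≤ _ := t2
      _ ≤ _ := mul_le_mul t3 t4 t40 (t30.trans t3)
  have hlim : Tendsto (fun s : Finset (Fin d → ℤ) => ‖∑ k ∈ s, (mFourierCoeff f k • mFourier k y - mFourierCoeff f k • mFourier k z)‖ ^ 2) atTop (nhds (‖f y - f z‖ ^ 2)) :=
    (Filter.Tendsto.norm hd).pow 2
  exact le_of_tendsto' hlim hfin

lemma descend {d : ℕ} (f : (Fin d → ℝ) → ℂ) (hf : Continuous f)
    (hp : ∀ x i, f (x + Pi.single i 1) = f x) :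
    ∃ g : C(UnitAddTorus (Fin d), ℂ), ∀ x : Fin d → ℝ, g (fun i => (x i : UnitAddCircle)) = f x := by
  have hq : IsOpenQuotientMap (Pi.map (fun (_ : Fin d) (t : ℝ) => (t : UnitAddCircle))) :=
    IsOpenQuotientMap.piMap (fun i => QuotientAddGroup.isOpenQuotientMap_mk)
  have hz : ∀ (x : Fin d → ℝ) (i : Fin d) (n : ℤ), f (x + Pi.single i (n : ℝ)) = f x := by
    intro x i n
    induction n using Int.induction_on with
    | zero => simp
    | succ n ih =>
      push_cast at ih ⊢
      rw [Pi.single_add, ← add_assoc, hp, ih]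
    | pred n ih =>
      push_cast at ih ⊢
      rw [← hp, add_assoc, ← Pi.single_add, sub_add_cancel, ih]
  have hs : ∀ (s : Finset (Fin d)) (n : Fin d → ℤ) (x : Fin d → ℝ), f (x + ∑ i ∈ s, Pi.single i (n i : ℝ)) = f x := by
    intro s n
    induction s using Finset.induction_on with
    | empty => simp
    | insert a s ha ih =>
      intro x
      rw [Finset.sum_insert ha, ← add_assoc, ih, hz]
  have hall : ∀ x y : Fin d → ℝ, (Pi.map (fun (_ : Fin d) (t : ℝ) => (t : UnitAddCircle))) x = (Pi.map (fun (_ : Fin d) (t : ℝ) => (t : UnitAddCircle))) y → f x = f y := by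
    intro x y h
    have : ∀ i, ∃ n : ℤ, y i = x i + n := by
      intro i
      have h1 := congrFun h i
      simp only [Pi.map_apply] at h1
      rw [QuotientAddGroup.eq, AddSubgroup.mem_zmultiples_iff] at h1
      obtain ⟨n, hn⟩ := h1
      exact ⟨n, by simp at hn; linarith⟩
    choose n hn using this
    have : y = x + ∑ i, Pi.single i (n i : ℝ) := by
      rw [Finset.univ_sum_single]
      ext i; exact hn i
    rw [this, hs]
  set p : C(Fin d → ℝ, UnitAddTorus (Fin d)) :=
    ⟨Pi.map (fun (_ : Fin d) (t : ℝ) => (t : UnitAddCircle)), hq.continuous⟩ with hpdef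
  have hq' : Topology.IsQuotientMap p := hq.isQuotientMap
  have hall' : Function.FactorsThrough (⟨f, hf⟩ : C(Fin d → ℝ, ℂ)) p := fun x y h => hall x y h
  refine ⟨hq'.lift ⟨f, hf⟩ hall', fun x => ?_⟩
  exact congrArg (fun (h : C(Fin d → ℝ, ℂ)) => h x) (hq'.lift_comp ⟨f, hf⟩ hall')


def Amap {d : ℕ} (P : Fin d → ℝ) : (Fin d → ℝ) →L[ℝ] EuclideanSpace ℝ (Fin d) :=
  ((EuclideanSpace.equiv (Fin d) ℝ).symm : (Fin d → ℝ) →L[ℝ] EuclideanSpace ℝ (Fin d)).comp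
    (ContinuousLinearMap.pi fun i => P i • ContinuousLinearMap.proj i)

lemma Amap_apply {d : ℕ} (P : Fin d → ℝ) (x : Fin d → ℝ) (i : Fin d) :
    Amap P x i = P i * x i := by
  simp [Amap]

lemma Amap_single {d : ℕ} (P : Fin d → ℝ) (i : Fin d) :
    Amap P (Pi.single i 1) = EuclideanSpace.single i (P i) := by
  ext j
  rw [Amap_apply]
  by_cases h : j = i
  · subst h; simp
  · simp [h]

lemma Amap_single' {d : ℕ} (P : Fin d → ℝ) (i : Fin d) :
    Amap P (Pi.single i 1) = (P i) • EuclideanSpace.single i (1:ℝ) := by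
  rw [Amap_single]
  ext j
  by_cases h : j = i
  · subst h; simp
  · simp [h]

lemma box_ae (d : ℕ) : box d =ᵐ[volume] Set.Icc (0 : Fin d → ℝ) 1 := by
  have := (Measure.univ_pi_Ioc_ae_eq_Icc (μ := fun _ : Fin d => (volume : Measure ℝ)) (f := 0) (g := 1))
  rw [← volume_pi] at this
  have e : box d = Set.univ.pi fun i => Set.Ioc ((0 : Fin d → ℝ) i) ((1 : Fin d → ℝ) i) := by
    ext x
    simp [box, Set.mem_pi]
  rw [e]
  exact this

lemma change_var {d : ℕ} (L : ℝ) (γ : Fin d → ℝ) (hP : ∀ i, 0 < L * γ i)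
    (u : EuclideanSpace ℝ (Fin d) → ℂ) :
    ∫ x in fund d L γ, u x = ((∏ i, L * γ i : ℝ) : ℂ) * ∫ x in box d, u (Amap (fun i => L * γ i) x) := by
  set P := fun i => L * γ i with hPdef
  have hdet : (Matrix.diagonal P).det ≠ 0 := by
    rw [Matrix.det_diagonal]
    exact (Finset.prod_pos (fun i _ => hP i)).ne'
  have h1 := (PiLp.volume_preserving_toLp (Fin d)).setIntegral_preimage_emb
    (MeasurableEquiv.toLp 2 (Fin d → ℝ)).measurableEmbedding u (fund d L γ)
  rw [← h1]
  have hv := Real.smul_map_diagonal_volume_pi hdet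
  have hemb : MeasurableEmbedding (Matrix.toLin' (Matrix.diagonal P)) := by
    refine Continuous.measurableEmbedding (LinearMap.continuous_of_finiteDimensional _) ?_
    intro x y hxy
    funext i
    have := congrFun hxy i
    simp only [Matrix.toLin'_apply, Matrix.mulVec_diagonal] at this
    exact mul_left_cancel₀ (hP i).ne' this
  conv_lhs => rw [← hv]
  rw [Measure.restrict_smul, integral_smul_measure, hemb.setIntegral_map]
  rw [Matrix.det_diagonal, abs_of_pos (Finset.prod_pos (fun i _ => hP i)),
    ENNReal.toReal_ofReal (Finset.prod_nonneg (fun i _ => (hP i).le)), Complex.real_smul]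
  congr 1
  have hset : (Matrix.toLin' (Matrix.diagonal P)) ⁻¹' (WithLp.toLp 2 ⁻¹' fund d L γ) =
      Set.pi Set.univ (fun i => Set.Ico (0:ℝ) 1) := by
    ext x
    simp only [Set.mem_preimage, fund, Set.mem_setOf_eq, Matrix.toLin'_apply,
      Matrix.mulVec_diagonal, Set.mem_pi, Set.mem_univ, true_implies, Set.mem_Ico]
    refine forall_congr' fun i => ?_
    have := hP i
    constructor
    · rintro ⟨a, b⟩
      exact ⟨by by_contra hc; push Not at hc; nlinarith, by by_contra hc; push Not at hc; nlinarith⟩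
    · rintro ⟨a, b⟩
      exact ⟨by positivity, by nlinarith⟩
  rw [hset]
  have hae : (Set.pi Set.univ (fun _ : Fin d => Set.Ico (0:ℝ) 1)) =ᵐ[volume] box d := by
    have := (Measure.univ_pi_Ico_ae_eq_Icc (μ := fun _ : Fin d => (volume : Measure ℝ)) (f := 0) (g := 1))
    rw [← volume_pi] at this
    exact this.trans (box_ae d).symm
  rw [setIntegral_congr_set hae]
  congr 1
  funext x
  congr 1
  ext i
  simp [Amap_apply, Matrix.mulVec_diagonal]

lemma div0 {n : ℕ} (u : Fin (n+1) → (Fin (n+1) → ℝ) → ℂ)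
    (u' : Fin (n+1) → (Fin (n+1) → ℝ) → (Fin (n+1) → ℝ) →L[ℝ] ℂ)
    (hu : ∀ i x, HasFDerivAt (u i) (u' i x) x)
    (hc : Continuous (fun x => ∑ i, u' i x (Pi.single i 1)))
    (hp : ∀ i x, u i (x + Pi.single i 1) = u i x) :
    ∫ x in box (n+1), ∑ i, u' i x (Pi.single i 1) = 0 := by
  rw [setIntegral_congr_set (box_ae (n+1))]
  rw [integral_divergence_of_hasFDerivAt_off_countable' (0 : Fin (n+1) → ℝ) 1 zero_le_one u u' ∅
    Set.countable_empty (fun i => (continuous_iff_continuousAt.2 fun x => (hu i x).continuousAt).continuousOn)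
    (fun x _ i => hu i x) (hc.continuousOn.integrableOn_compact isCompact_Icc)]
  refine Finset.sum_eq_zero fun i _ => ?_
  rw [sub_eq_zero]
  congr 1
  funext x
  have e : i.insertNth ((1 : Fin (n+1) → ℝ) i) x =
      (i.insertNth ((0 : Fin (n+1) → ℝ) i) x : Fin (n+1) → ℝ) + Pi.single i 1 := by
    funext j
    refine Fin.succAboveCases i ?_ ?_ j
    · simp
    · intro j; simp
  change u i (i.insertNth ((1 : Fin (n+1) → ℝ) i) x) = u i (i.insertNth ((0 : Fin (n+1) → ℝ) i) x)
  rw [e, hp]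

def ek {d : ℕ} (k : Fin d → ℤ) (x : Fin d → ℝ) : ℂ :=
  Complex.exp (-(2 * π * Complex.I) * ∑ j, (k j : ℂ) * (x j : ℂ))

lemma mF_eq {d : ℕ} (k : Fin d → ℤ) (x : Fin d → ℝ) :
    mFourier (-k) (fun i => (x i : UnitAddCircle)) = ek k x := by
  simp only [mFourier, ContinuousMap.coe_mk, fourier_coe_apply, ek]
  rw [← Complex.exp_sum]
  congr 1
  rw [Finset.mul_sum]
  refine Finset.sum_congr rfl fun i _ => ?_
  simp; ring

lemma ek_deriv {d : ℕ} (k : Fin d → ℤ) (x : Fin d → ℝ) :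
    ∃ D : (Fin d → ℝ) →L[ℝ] ℂ, HasFDerivAt (ek k) D x ∧
      ∀ i, D (Pi.single i 1) = -(2 * π * Complex.I * k i) * ek k x := by
  have h : HasFDerivAt (fun x : Fin d → ℝ => -(2 * π * Complex.I) * ∑ j, (k j : ℂ) * (x j : ℂ))
      ((-(2 * π * Complex.I)) • ∑ j, (k j : ℂ) • (Complex.ofRealCLM.comp (ContinuousLinearMap.proj j : (Fin d → ℝ) →L[ℝ] ℝ))) x := by
    refine HasFDerivAt.const_mul ?_ _
    refine HasFDerivAt.fun_sum fun j _ => ?_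
    refine HasFDerivAt.const_mul ?_ _
    exact (Complex.ofRealCLM.comp (ContinuousLinearMap.proj j : (Fin d → ℝ) →L[ℝ] ℝ)).hasFDerivAt
  refine ⟨_, h.cexp, fun i => ?_⟩
  simp only [ContinuousLinearMap.smul_apply, ContinuousLinearMap.sum_apply, ContinuousLinearMap.comp_apply, ContinuousLinearMap.proj_apply, smul_eq_mul, Complex.ofRealCLM_apply]
  have e : ∑ j, (k j : ℂ) * (((Pi.single i 1 : Fin d → ℝ) j : ℝ) : ℂ) = k i := by
    rw [Finset.sum_eq_single i]
    · simp
    · intro j _ hj; simp [hj]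
    · simp
  rw [e, ek]; ring

lemma ek_periodic {d : ℕ} (k : Fin d → ℤ) (x : Fin d → ℝ) (i : Fin d) :
    ek k (x + Pi.single i 1) = ek k x := by
  rw [← mF_eq, ← mF_eq]
  congr 1
  funext j
  by_cases h : j = i
  · subst h; simp
  · simp [h]

lemma ek_cont {d : ℕ} (k : Fin d → ℤ) : Continuous (ek k) := by
  unfold ek; fun_prop

lemma lap_cont {d : ℕ} (F : EuclideanSpace ℝ (Fin d) → ℂ) (hF : ContDiff ℝ 2 F) :
    Continuous (lap d F) := by
  unfold lap
  refine continuous_finset_sum _ fun i _ => ?_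
  have h1 : ContDiff ℝ 1 (fun y => fderiv ℝ F y (EuclideanSpace.single i 1)) :=
    (hF.fderiv_right (m := 1) (by norm_num)).clm_apply contDiff_const
  exact (h1.continuous_fderiv (by norm_num)).clm_apply continuous_const

lemma fderiv_per {d : ℕ} {F : EuclideanSpace ℝ (Fin d) → ℂ} {v : EuclideanSpace ℝ (Fin d)}
    (h : ∀ x, F (x + v) = F x) (x : EuclideanSpace ℝ (Fin d)) :
    fderiv ℝ F (x + v) = fderiv ℝ F x := by
  rw [← fderiv_comp_add_right]
  congr 1
  funext y; exact h y

lemma lap_per {d : ℕ} {F : EuclideanSpace ℝ (Fin d) → ℂ} {v : EuclideanSpace ℝ (Fin d)}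
    (h : ∀ x, F (x + v) = F x) (x : EuclideanSpace ℝ (Fin d)) :
    lap d F (x + v) = lap d F x := by
  unfold lap
  refine Finset.sum_congr rfl fun i _ => ?_
  rw [fderiv_per (F := fun y => fderiv ℝ F y (EuclideanSpace.single i 1))]
  intro y
  rw [fderiv_per h]

lemma green {n : ℕ} (P : Fin (n+1) → ℝ) (hP : ∀ i, 0 < P i)
    (F : EuclideanSpace ℝ (Fin (n+1)) → ℂ) (hF : ContDiff ℝ 2 F)
    (hper : ∀ x i, F (x + EuclideanSpace.single i (P i)) = F x) (k : Fin (n+1) → ℤ) :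
    ∫ x in box (n+1), ek k x * (-lap (n+1) F (Amap P x)) =
      ((∑ i, (2 * π * (k i : ℝ) / P i) ^ 2 : ℝ) : ℂ) * ∫ x in box (n+1), ek k x * F (Amap P x) := by
  choose D hD hDi using ek_deriv k
  set g : Fin (n+1) → EuclideanSpace ℝ (Fin (n+1)) → ℂ :=
    fun i y => fderiv ℝ F y (EuclideanSpace.single i 1) with hg
  have hg1 : ∀ i, ContDiff ℝ 1 (g i) := fun i =>
    (hF.fderiv_right (m := 1) (by norm_num)).clm_apply contDiff_const
  have hFd : ∀ x, HasFDerivAt (fun x => F (Amap P x)) ((fderiv ℝ F (Amap P x)).comp (Amap P)) x :=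
    fun x => ((hF.differentiable (by norm_num)) _).hasFDerivAt.comp x (Amap P).hasFDerivAt
  have hgd : ∀ i x, HasFDerivAt (fun x => g i (Amap P x)) ((fderiv ℝ (g i) (Amap P x)).comp (Amap P)) x :=
    fun i x => (((hg1 i).differentiable (by norm_num)) _).hasFDerivAt.comp x (Amap P).hasFDerivAt
  have hud := fun i x => (hD x).mul (((hgd i x).const_mul ((P i : ℂ)⁻¹)).add
    ((hFd x).const_mul ((P i : ℂ)⁻¹ ^ 2 * (2 * π * Complex.I * k i))))
  have hPc : ∀ i, (P i : ℂ) ≠ 0 := fun i => by exact_mod_cast (hP i).ne'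
  have key : ∀ x, ∑ i, (ek k x • ((P i : ℂ)⁻¹ • (fderiv ℝ (g i) (Amap P x)).comp (Amap P) +
        ((P i : ℂ)⁻¹ ^ 2 * (2 * π * Complex.I * k i)) • (fderiv ℝ F (Amap P x)).comp (Amap P)) +
        ((P i : ℂ)⁻¹ * g i (Amap P x) + (P i : ℂ)⁻¹ ^ 2 * (2 * π * Complex.I * k i) * F (Amap P x)) • D x)
        (Pi.single i 1) =
      ((∑ i, (2 * π * (k i : ℝ) / P i) ^ 2 : ℝ) : ℂ) * (ek k x * F (Amap P x)) -
        ek k x * (-lap (n+1) F (Amap P x)) := by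
    intro x
    rw [lap, mul_neg, sub_neg_eq_add, Finset.mul_sum, Complex.ofReal_sum, Finset.sum_mul,
      ← Finset.sum_add_distrib]
    refine Finset.sum_congr rfl fun i _ => ?_
    simp only [ContinuousLinearMap.add_apply, ContinuousLinearMap.smul_apply,
      ContinuousLinearMap.comp_apply, hDi, Amap_single', map_smul, smul_eq_mul, Complex.real_smul]
    have := hPc i
    change ek k x * ((P i : ℂ)⁻¹ * ((P i : ℂ) * fderiv ℝ (g i) (Amap P x) (EuclideanSpace.single i 1)) +
      (P i : ℂ)⁻¹ ^ 2 * (2 * π * Complex.I * k i) * ((P i : ℂ) * g i (Amap P x))) +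
      ((P i : ℂ)⁻¹ * g i (Amap P x) + (P i : ℂ)⁻¹ ^ 2 * (2 * π * Complex.I * k i) * F (Amap P x)) *
        (-(2 * π * Complex.I * k i) * ek k x) = 
      _ + ek k x * fderiv ℝ (g i) (Amap P x) (EuclideanSpace.single i 1)
    push_cast
    field_simp
    ring_nf
    simp only [Complex.I_sq]
    ring
  have hFc : Continuous (fun x => F (Amap P x)) := hF.continuous.comp (Amap P).continuous
  have hLc : Continuous (fun x => lap (n+1) F (Amap P x)) := (lap_cont F hF).comp (Amap P).continuous
  have hEc := ek_cont k
  have h0 := div0 _ _ hud (by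
      refine (continuous_congr key).2 ?_
      fun_prop) (by
      intro i x
      have hA : Amap P (x + Pi.single i 1) = Amap P x + EuclideanSpace.single i (P i) := by
        rw [map_add, Amap_single]
      have hgp : g i (Amap P x + EuclideanSpace.single i (P i)) = g i (Amap P x) := by
        simp only [hg]; rw [fderiv_per (fun y => hper y i)]
      simp only [Pi.mul_apply, Pi.add_apply, ek_periodic, hA, hgp, hper])
  have hint : ∀ v : (Fin (n+1) → ℝ) → ℂ, Continuous v → IntegrableOn v (box (n+1)) := by
    intro v hv
    exact (hv.continuousOn.integrableOn_compact isCompact_Icc).congr_set_ae (box_ae (n+1))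
  replace h0 : ∫ x in box (n+1), (((∑ i, (2 * π * (k i : ℝ) / P i) ^ 2 : ℝ) : ℂ) * (ek k x * F (Amap P x)) -
        ek k x * (-lap (n+1) F (Amap P x))) = 0 := by
    rw [← h0]
    congr 1
    funext x
    exact (key x).symm
  rw [integral_sub (hint _ (by fun_prop)) (hint _ (by fun_prop)), integral_const_mul, sub_eq_zero] at h0
  exact h0.symm


lemma ek_diff {d : ℕ} (k : Fin d → ℤ) (P : Fin d → ℝ) (hP : ∀ i, 0 < P i) (y z : Fin d → ℝ) (ρ : ℝ)
    (hρ : ‖Amap P y - Amap P z‖ ≤ ρ) :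
    ‖ek k y - ek k z‖ ^ 2 ≤ ρ ^ 2 * ∑ i, (2 * π * (k i : ℝ) / P i) ^ 2 := by
  set a : ℝ := -(2 * π) * ∑ j, (k j : ℝ) * y j with ha
  set b : ℝ := -(2 * π) * ∑ j, (k j : ℝ) * z j with hb
  have e1 : ek k y = Complex.exp (Complex.I * (a : ℂ)) := by
    rw [ek, ha]; push_cast; congr 1; ring
  have e2 : ek k z = Complex.exp (Complex.I * (b : ℂ)) := by
    rw [ek, hb]; push_cast; congr 1; ring
  have e3 : ek k y - ek k z = Complex.exp (Complex.I * (b : ℂ)) *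
      (Complex.exp (Complex.I * ((a - b : ℝ) : ℂ)) - 1) := by
    rw [e1, e2, mul_sub, ← Complex.exp_add, mul_one]
    congr 2
    push_cast; ring
  have h1 : ‖ek k y - ek k z‖ ≤ |a - b| := by
    rw [e3, norm_mul, Complex.norm_exp_I_mul_ofReal, one_mul]
    exact Real.norm_exp_I_mul_ofReal_sub_one_le
  have h2 : a - b = - ∑ i, (2 * π * (k i : ℝ) / P i) * (Amap P y - Amap P z) i := by
    rw [ha, hb, ← mul_sub, ← Finset.sum_sub_distrib, neg_mul, Finset.mul_sum]
    congr 1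
    refine Finset.sum_congr rfl fun i _ => ?_
    have := (hP i).ne'
    rw [PiLp.sub_apply, Amap_apply, Amap_apply]
    field_simp
  have h3 : (a - b) ^ 2 ≤ (∑ i, (2 * π * (k i : ℝ) / P i) ^ 2) * ‖Amap P y - Amap P z‖ ^ 2 := by
    rw [h2, neg_sq, EuclideanSpace.real_norm_sq_eq]
    exact Finset.sum_mul_sq_le_sq_mul_sq _ _ _
  have h4 : ‖Amap P y - Amap P z‖ ^ 2 ≤ ρ ^ 2 := pow_le_pow_left₀ (norm_nonneg _) hρ 2
  have h5 : ‖ek k y - ek k z‖ ^ 2 ≤ (a - b) ^ 2 := by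
    rw [← sq_abs (a - b)]; exact pow_le_pow_left₀ (norm_nonneg _) h1 2
  have h6 : 0 ≤ ∑ i, (2 * π * (k i : ℝ) / P i) ^ 2 := Finset.sum_nonneg fun i _ => sq_nonneg _
  nlinarith

lemma core {n : ℕ} (hn : n + 1 ≤ 3) (P : Fin (n+1) → ℝ) (ρ : ℝ) (hρ : 1 ≤ ρ) (hPρ : ∀ i, ρ ≤ P i)
    (F : EuclideanSpace ℝ (Fin (n+1)) → ℂ) (hF : ContDiff ℝ 2 F)
    (hper : ∀ x i, F (x + EuclideanSpace.single i (P i)) = F x) (A B : ℝ)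
    (hA : A = (∫ x in box (n+1), (starRingEnd ℂ) (F (Amap P x)) * (-lap (n+1) F (Amap P x))).re)
    (hB : B = (∫ x in box (n+1), (starRingEnd ℂ) (-lap (n+1) F (Amap P x)) *
      (-lap (n+1) F (Amap P x))).re) :
    0 ≤ A ∧ ∀ x₁ x₂, ‖x₁ - x₂‖ ≤ ρ → ‖F x₁ - F x₂‖ ^ 2 ≤
      8 * (A + B) * ((∏ i, P i) * (16 * 32 * 12 ^ 3 * ρ ^ (4 - (n+1)))) := by
  have hP : ∀ i, 0 < P i := fun i => by linarith [hPρ i]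
  have hs : ∀ x i, Amap P (x + Pi.single i 1) = Amap P x + EuclideanSpace.single i (P i) := by
    intro x i; rw [map_add, Amap_single]
  obtain ⟨f, hf⟩ := descend (fun x => F (Amap P x)) (hF.continuous.comp (Amap P).continuous)
    (by intro x i; simp only [hs, hper])
  obtain ⟨g, hg⟩ := descend (fun x => -lap (n+1) F (Amap P x))
    ((lap_cont F hF).comp (Amap P).continuous).neg
    (by intro x i; simp only [hs]; rw [lap_per (fun y => hper y i)])
  have hm := fourier_main f g (fun k => ∑ i, (2 * π * (k i : ℝ) / P i) ^ 2)
    (fun k => Finset.sum_nonneg fun i _ => sq_nonneg _) (by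
      intro k
      rw [mFourierCoeff_eq_integral _ _ (fun _ => 0), mFourierCoeff_eq_integral _ _ (fun _ => 0)]
      simp only [mF_eq, hf, hg, smul_eq_mul]
      exact green P hP F hF hper k) A B (by rw [hA]; simp only [hf, hg]) (by rw [hB]; simp only [hg])
  refine ⟨hm.1, fun x₁ x₂ hx => ?_⟩
  have hsurj : ∀ x : EuclideanSpace ℝ (Fin (n+1)), ∃ y, Amap P y = x := by
    intro x
    refine ⟨fun i => x i / P i, ?_⟩
    ext i
    rw [Amap_apply]
    field_simp [(hP i).ne']
  obtain ⟨y, rfl⟩ := hsurj x₁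
  obtain ⟨z, rfl⟩ := hsurj x₂
  have := hm.2 ρ hρ _ (lattice_sum (n+1) (by omega) hn ρ hρ P hPρ)
    (fun i => (y i : UnitAddCircle)) (fun i => (z i : UnitAddCircle)) (by
      intro k
      have e := ek_diff (-k) P hP y z ρ hx
      rw [← mF_eq, ← mF_eq, neg_neg] at e
      refine e.trans (le_of_eq ?_)
      congr 1
      refine Finset.sum_congr rfl fun i _ => ?_
      simp only [Pi.neg_apply, Int.cast_neg]
      ring)
  rwa [hf, hf] at this


lemma int_box {d : ℕ} {X : Type*} [NormedAddCommGroup X] (v : (Fin d → ℝ) → X) (hv : Continuous v) :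
    IntegrableOn v (box d) :=
  (hv.continuousOn.integrableOn_compact isCompact_Icc).congr_set_ae (box_ae d)

lemma ortho_sum {d m : ℕ} (φ : Fin m → (Fin d → ℝ) → ℂ) (hφ : ∀ j, Continuous (φ j)) (κ : ℝ)
    (ho : ∀ j k, ∫ x in box d, φ j x * (starRingEnd ℂ) (φ k x) = if j = k then (κ : ℂ) else 0)
    (a b : Fin m → ℂ) :
    ∫ x in box d, (starRingEnd ℂ) (∑ j, a j * φ j x) * (∑ j, b j * φ j x) =
      κ * ∑ j, (starRingEnd ℂ) (a j) * b j := by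
  have e : ∀ x, (starRingEnd ℂ) (∑ j, a j * φ j x) * (∑ j, b j * φ j x) =
      ∑ j, ∑ k, ((starRingEnd ℂ) (a j) * b k) * (φ k x * (starRingEnd ℂ) (φ j x)) := by
    intro x
    rw [map_sum, Finset.sum_mul_sum]
    refine Finset.sum_congr rfl fun j _ => Finset.sum_congr rfl fun k _ => ?_
    rw [map_mul]; ring
  have hcj : ∀ j, Continuous (fun x => (starRingEnd ℂ) (φ j x)) := fun j =>
    Complex.continuous_conj.comp (hφ j)
  simp only [e]
  rw [integral_finsetSum _ (fun j _ => int_box _ (by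
    have := hcj j
    fun_prop))]
  rw [Finset.mul_sum]
  refine Finset.sum_congr rfl fun j _ => ?_
  rw [integral_finsetSum _ (fun k _ => int_box _ (by
    have := hcj j
    fun_prop))]
  simp only [integral_const_mul, ho]
  simp; ring

lemma energy_s14 {d m : ℕ} (φ : Fin m → (Fin d → ℝ) → ℂ) (hφ : ∀ j, Continuous (φ j)) (κ : ℝ) (hκ : 0 ≤ κ)
    (ho : ∀ j k, ∫ x in box d, φ j x * (starRingEnd ℂ) (φ k x) = if j = k then (κ : ℂ) else 0)
    (c : Fin m → ℂ) (hc : ∑ j, ‖c j‖ ^ 2 = 1) (lam : Fin m → ℝ) (E : ℝ) (hE : 0 < E) (hE1 : E < 1)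
    (hl : ∀ j, lam j ∈ Set.Icc E (2 * E)) (V : (Fin d → ℝ) → ℝ) (Vs : ℝ) (hV0 : ∀ x, 0 ≤ V x)
    (hV : ∀ x, V x ≤ Vs) (f g : (Fin d → ℝ) → ℂ) (hgc : Continuous g)
    (hf : ∀ x, f x = ∑ j, c j * φ j x)
    (hg : ∀ x, g x = ∑ j, (c j * lam j) * φ j x - V x * f x) (A B : ℝ)
    (hA : A = (∫ x in box d, (starRingEnd ℂ) (f x) * g x).re) 
    (hB : B = (∫ x in box d, (starRingEnd ℂ) (g x) * g x).re) (hA0 : 0 ≤ A) :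
    A + B ≤ κ * (10 * E + 4 * E * Vs) := by
  set k : (Fin d → ℝ) → ℂ := fun x => ∑ j, (c j * lam j) * φ j x with hk
  set w : (Fin d → ℝ) → ℂ := fun x => V x * f x with hw
  have hVs : 0 ≤ Vs := (hV0 0).trans (hV 0)
  have hfc : Continuous f := by
    have : f = fun x => ∑ j, c j * φ j x := funext hf
    rw [this]; fun_prop
  have hkc : Continuous k := by rw [hk]; fun_prop
  have hwc : Continuous w := by
    have : w = fun x => k x - g x := by
      funext x; rw [hg]; simp [hk, hw]
    rw [this]; fun_prop
  have hcf : Continuous (fun x => (starRingEnd ℂ) (f x)) := Complex.continuous_conj.comp hfc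
  have hcg : Continuous (fun x => (starRingEnd ℂ) (g x)) := Complex.continuous_conj.comp hgc
  have hck : Continuous (fun x => (starRingEnd ℂ) (k x)) := Complex.continuous_conj.comp hkc
  have hfk : ∫ x in box d, (starRingEnd ℂ) (f x) * k x = ((κ * ∑ j, lam j * ‖c j‖ ^ 2 : ℝ) : ℂ) := by
    simp only [hf, hk]
    rw [ortho_sum φ hφ κ ho]
    push_cast
    congr 1
    refine Finset.sum_congr rfl fun j _ => ?_
    rw [← mul_assoc, Complex.conj_mul']; ring
  have hkk : ∫ x in box d, (starRingEnd ℂ) (k x) * k x = ((κ * ∑ j, lam j ^ 2 * ‖c j‖ ^ 2 : ℝ) : ℂ) := by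
    simp only [hk]
    rw [ortho_sum φ hφ κ ho]
    push_cast
    congr 1
    refine Finset.sum_congr rfl fun j _ => ?_
    rw [map_mul, Complex.conj_ofReal, ← Complex.conj_mul']; ring
  have hwv : ∀ x, (starRingEnd ℂ) (f x) * w x = ((V x * ‖f x‖ ^ 2 : ℝ) : ℂ) := by
    intro x
    push_cast
    rw [← Complex.conj_mul']; simp only [hw]; ring
  have hvc : Continuous (fun x => V x * ‖f x‖ ^ 2) := by
    have : (fun x => V x * ‖f x‖ ^ 2) = fun x => ((starRingEnd ℂ) (f x) * w x).re := by
      funext x; rw [hwv, Complex.ofReal_re]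
    rw [this]
    exact Complex.continuous_re.comp (hcf.mul hwc)
  set v : ℝ := ∫ x in box d, V x * ‖f x‖ ^ 2 with hv
  have hv0 : 0 ≤ v := integral_nonneg fun x => mul_nonneg (hV0 x) (sq_nonneg _)
  have hA' : A = κ * ∑ j, lam j * ‖c j‖ ^ 2 - v := by
    have e : ∀ x, (starRingEnd ℂ) (f x) * g x = (starRingEnd ℂ) (f x) * k x - ((V x * ‖f x‖ ^ 2 : ℝ) : ℂ) := by
      intro x; rw [← hwv, hg]; simp only [hk, hw]; ring
    rw [hA]
    simp only [e]
    rw [integral_sub (int_box _ (by exact hcf.mul hkc)) (int_box _ (by exact Complex.continuous_ofReal.comp hvc)), hfk,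
      integral_complex_ofReal, Complex.sub_re, Complex.ofReal_re, Complex.ofReal_re]
  have hS1 : ∑ j, lam j * ‖c j‖ ^ 2 ≤ 2 * E := by
    calc _ ≤ ∑ j, 2 * E * ‖c j‖ ^ 2 := Finset.sum_le_sum fun j _ =>
            mul_le_mul_of_nonneg_right (hl j).2 (sq_nonneg _)
      _ = 2 * E := by rw [← Finset.mul_sum, hc, mul_one]
  have hS2 : ∑ j, lam j ^ 2 * ‖c j‖ ^ 2 ≤ 4 * E := by
    calc _ ≤ ∑ j, 4 * E * ‖c j‖ ^ 2 := Finset.sum_le_sum fun j _ =>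
            mul_le_mul_of_nonneg_right (by nlinarith [(hl j).1, (hl j).2]) (sq_nonneg _)
      _ = 4 * E := by rw [← Finset.mul_sum, hc, mul_one]
  have hS1' : κ * ∑ j, lam j * ‖c j‖ ^ 2 ≤ κ * (2 * E) := mul_le_mul_of_nonneg_left hS1 hκ
  have hS2' : κ * ∑ j, lam j ^ 2 * ‖c j‖ ^ 2 ≤ κ * (4 * E) := mul_le_mul_of_nonneg_left hS2 hκ
  have hsq : ∀ u : (Fin d → ℝ) → ℂ, ∫ x in box d, (starRingEnd ℂ) (u x) * u x =
      ((∫ x in box d, ‖u x‖ ^ 2 : ℝ) : ℂ) := by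
    intro u
    rw [← integral_complex_ofReal]
    congr 1
    funext x
    rw [Complex.conj_mul']; push_cast; rfl
  have hB' : B ≤ 2 * (κ * ∑ j, lam j ^ 2 * ‖c j‖ ^ 2) + 2 * Vs * v := by
    have hkk' : ∫ x in box d, ‖k x‖ ^ 2 = κ * ∑ j, lam j ^ 2 * ‖c j‖ ^ 2 := by
      have := hsq k
      rw [hkk] at this
      exact_mod_cast this.symm
    rw [hB, hsq, Complex.ofReal_re, ← hkk', hv, ← integral_const_mul, ← integral_const_mul,
      ← integral_add (int_box _ (by fun_prop)) (int_box _ (by fun_prop))]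
    refine integral_mono (int_box _ (by fun_prop)) (int_box _ (by fun_prop)) fun x => ?_
    have h1 : g x = k x - w x := hg x
    have h2 : ‖g x‖ ≤ ‖k x‖ + ‖w x‖ := by rw [h1]; exact norm_sub_le _ _
    have h3 : ‖w x‖ = V x * ‖f x‖ := by
      simp only [hw]
      rw [norm_mul, Complex.norm_real, Real.norm_of_nonneg (hV0 x)]
    have h4 : ‖w x‖ ^ 2 ≤ Vs * (V x * ‖f x‖ ^ 2) := by
      rw [h3, mul_pow]
      have := mul_le_mul_of_nonneg_right (hV x) (mul_nonneg (hV0 x) (sq_nonneg ‖f x‖))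
      nlinarith
    have h5 : ‖g x‖ ^ 2 ≤ (‖k x‖ + ‖w x‖) ^ 2 := pow_le_pow_left₀ (norm_nonneg _) h2 2
    change ‖g x‖ ^ 2 ≤ 2 * ‖k x‖ ^ 2 + 2 * Vs * (V x * ‖f x‖ ^ 2)
    nlinarith [sq_nonneg (‖k x‖ - ‖w x‖)]
  have : Vs * v ≤ Vs * (κ * (2 * E)) := mul_le_mul_of_nonneg_left (by linarith) hVs
  nlinarith


lemma lap_lin {d m : ℕ} (Ψ : Fin m → EuclideanSpace ℝ (Fin d) → ℂ) (hΨ : ∀ j, ContDiff ℝ 2 (Ψ j))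
    (c : Fin m → ℂ) (x : EuclideanSpace ℝ (Fin d)) :
    lap d (fun y => ∑ j, c j * Ψ j y) x = ∑ j, c j * lap d (Ψ j) x := by
  have h1 : ∀ y i, fderiv ℝ (fun y => ∑ j, c j * Ψ j y) y (EuclideanSpace.single i 1) =
      ∑ j, c j * fderiv ℝ (Ψ j) y (EuclideanSpace.single i 1) := by
    intro y i
    rw [(HasFDerivAt.fun_sum fun j _ => (((hΨ j).differentiable (by norm_num)) y).hasFDerivAt.const_mul (c j)).fderiv]
    simp
  have h2 : ∀ j i, Differentiable ℝ (fun y => fderiv ℝ (Ψ j) y (EuclideanSpace.single i (1:ℝ))) := fun j i =>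
    (((hΨ j).fderiv_right (m := 1) (by norm_num)).clm_apply contDiff_const).differentiable (by norm_num)
  unfold lap
  simp only [h1]
  have h3 : ∀ i, fderiv ℝ (fun y => ∑ j, c j * fderiv ℝ (Ψ j) y (EuclideanSpace.single i (1:ℝ))) x
      (EuclideanSpace.single i 1) = ∑ j, c j * fderiv ℝ (fun y => fderiv ℝ (Ψ j) y (EuclideanSpace.single i (1:ℝ))) x
      (EuclideanSpace.single i 1) := by
    intro i
    rw [(HasFDerivAt.fun_sum fun j _ => ((h2 j i) x).hasFDerivAt.const_mul (c j)).fderiv]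
    simp
  simp only [h3]
  rw [Finset.sum_comm]
  simp only [Finset.mul_sum]

lemma per_comb {d : ℕ} {L : ℝ} {γ : Fin d → ℝ} {F : EuclideanSpace ℝ (Fin d) → ℂ}
    (hF : LatPeriodic d L γ F) (v : Fin d → ℤ) (x : EuclideanSpace ℝ (Fin d)) :
    F (x - ∑ i, (v i : ℝ) • latVec d L γ i) = F x := by
  have h1 : ∀ i, Function.Periodic F ((v i : ℝ) • latVec d L γ i) := by
    intro i
    have h : Function.Periodic F (latVec d L γ i) := fun y => hF y i
    have := h.zsmul (v i)
    rwa [← Int.cast_smul_eq_zsmul ℝ] at this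
  have h2 : ∀ s : Finset (Fin d), Function.Periodic F (∑ i ∈ s, (v i : ℝ) • latVec d L γ i) := by
    intro s
    induction s using Finset.induction_on with
    | empty => intro y; simp
    | insert a s ha ih =>
      rw [Finset.sum_insert ha]
      exact (h1 a).add_period ih
  exact (h2 Finset.univ).sub_eq x

lemma ball_rep {d : ℕ} {L : ℝ} {γ : Fin d → ℝ} {F : EuclideanSpace ℝ (Fin d) → ℂ}
    (hF : LatPeriodic d L γ F) {x₀ x : EuclideanSpace ℝ (Fin d)} {r : ℝ} (hx : x ∈ torusBall d L γ x₀ r) :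
    ∃ y, F y = F x ∧ ‖y - x₀‖ < r := by
  have hx' : torusDist d L γ x x₀ < r := hx
  obtain ⟨v, hv⟩ := exists_lt_of_ciInf_lt hx'
  refine ⟨x - ∑ i, (v i : ℝ) • latVec d L γ i, per_comb hF v x, ?_⟩
  rwa [sub_right_comm]

/-- **Variation bound for the spectral projector** (Section 4): there is an absolute
constant `c > 0` such that, for `d ≤ 3`, the normalized spectral projector
`F = N^{-1/2} ∑ h(λ) conj(Ψ_λ(x₀')) Ψ_λ` (with `‖h‖_∞ ≤ 1`, eigenvalues in `[E,2E]`,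
`0 < E < 1`) which satisfies `∫_{𝕋^d_L ∖ B(x₀,r)} |F|² dμ ≤ E` for some `1 ≤ r ≤ L/2`
obeys `|F(x₁) - F(x₂)| ≤ c r^{(4-d)/2} (1 + ‖V‖_∞) E^{1/2}` for all `x₁, x₂ ∈ B(x₀,r)`. -/
theorem spectral_projector_variation_bound :
    ∃ c : ℝ, 0 < c ∧
      ∀ (d : ℕ) (hd : 0 < d), d ≤ 3 →
      ∀ L : ℝ, 0 < L →
      ∀ γ : Fin d → ℝ, (∀ i, 1 ≤ γ i) → γ ⟨0, hd⟩ = 1 →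
      ∀ (V : EuclideanSpace ℝ (Fin d) → ℝ) (Vsup : ℝ),
        Measurable V → (∀ x, 0 ≤ V x) → (∀ x, V x ≤ Vsup) → LatPeriodic d L γ V →
      ∀ E : ℝ, 0 < E → E < 1 →
      ∀ (n : ℕ) (Ψ : Fin n → EuclideanSpace ℝ (Fin d) → ℂ) (lam : Fin n → ℝ),
        (∀ j, ContDiff ℝ 2 (Ψ j)) → (∀ j, LatPeriodic d L γ (Ψ j)) →
        (∀ j x, -lap d (Ψ j) x + (V x : ℂ) * Ψ j x = (lam j : ℂ) * Ψ j x) →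
        (∀ j, lam j ∈ Set.Icc E (2 * E)) →
        (∀ j k, (∫ x in fund d L γ, Ψ j x * (starRingEnd ℂ) (Ψ k x)) =
          if j = k then 1 else 0) →
      ∀ h : ℝ → ℝ, Continuous h → Function.support h ⊆ Set.Icc E (2 * E) →
        (∀ t, |h t| ≤ 1) →
      ∀ x₀' : EuclideanSpace ℝ (Fin d),
      ∀ N : ℝ, N = ∑ j, (h (lam j)) ^ 2 * ‖Ψ j x₀'‖ ^ 2 → N ≠ 0 →
      ∀ F : EuclideanSpace ℝ (Fin d) → ℂ,
        (∀ x, F x = ((N ^ (-(1:ℝ)/2) : ℝ) : ℂ) *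
          ∑ j, (h (lam j) : ℂ) * (starRingEnd ℂ) (Ψ j x₀') * Ψ j x) →
      ∀ (x₀ : EuclideanSpace ℝ (Fin d)) (r : ℝ), 1 ≤ r → r ≤ L / 2 →
        (∫ x in fund d L γ \ torusBall d L γ x₀ r, ‖F x‖ ^ 2) ≤ E →
      ∀ x₁ ∈ torusBall d L γ x₀ r, ∀ x₂ ∈ torusBall d L γ x₀ r,
        ‖F x₁ - F x₂‖ ≤ c * r ^ (((4:ℝ) - d) / 2) * (1 + Vsup) * E ^ ((1:ℝ)/2) := by
  refine ⟨Real.sqrt (320 * 8 * (16 * 32 * 12 ^ 3)), by positivity, ?_⟩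
  intro d hd hd3 L hL γ hγ _ V Vsup _ hV0 hV _ E hE hE1 m Ψ lam hΨ hΨp hΨe hl ho h _ _ _ x₀' N hN hN0 F hF
    x₀ r hr hrL _ x₁ hx₁ x₂ hx₂
  obtain ⟨n, rfl⟩ : ∃ n, d = n + 1 := ⟨d - 1, by omega⟩
  set P : Fin (n+1) → ℝ := fun i => L * γ i with hPdef
  have hPr : ∀ i, 2 * r ≤ P i := fun i => by
    have := mul_le_mul_of_nonneg_left (hγ i) hL.le
    simp only [hPdef]; linarith
  have hP : ∀ i, 0 < P i := fun i => by linarith [hPr i]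
  have hVol : 0 < ∏ i, P i := Finset.prod_pos fun i _ => hP i
  have hVs : 0 ≤ Vsup := (hV0 0).trans (hV 0)
  have hNpos : 0 < N := lt_of_le_of_ne (by rw [hN]; positivity) hN0.symm
  set c : Fin m → ℂ := fun j => ((N ^ (-(1:ℝ)/2) : ℝ) : ℂ) * ((h (lam j) : ℂ) * (starRingEnd ℂ) (Ψ j x₀')) with hc
  have hFc : F = fun x => ∑ j, c j * Ψ j x := by
    funext x
    rw [hF, Finset.mul_sum]
    refine Finset.sum_congr rfl fun j _ => ?_
    simp only [hc]; ring
  have hNN : (N ^ (-(1:ℝ)/2)) ^ 2 * N = 1 := by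
    rw [← Real.rpow_natCast, ← Real.rpow_mul hNpos.le]
    norm_num
    rw [Real.rpow_neg_one]
    exact inv_mul_cancel₀ hN0
  have hc1 : ∑ j, ‖c j‖ ^ 2 = 1 := by
    rw [← hNN]
    conv_rhs => rw [hN]
    rw [Finset.mul_sum]
    refine Finset.sum_congr rfl fun j _ => ?_
    rw [← hN]
    simp only [hc, norm_mul, Complex.norm_real, RCLike.norm_conj, mul_pow, Real.norm_eq_abs, sq_abs]
  have hF2 : ContDiff ℝ 2 F := by
    rw [hFc]
    exact ContDiff.sum fun j _ => contDiff_const.mul (hΨ j)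
  have hFp : LatPeriodic (n+1) L γ F := by
    intro x i
    rw [hFc]
    simp only [hΨp _ x i]
  have hlapF : ∀ x, -lap (n+1) F x = ∑ j, (c j * lam j) * Ψ j x - V x * F x := by
    intro x
    rw [hFc, lap_lin Ψ hΨ, ← Finset.sum_neg_distrib]
    simp only [Finset.mul_sum]
    rw [← Finset.sum_sub_distrib]
    refine Finset.sum_congr rfl fun j _ => ?_
    have := hΨe j x
    linear_combination c j * this
  have hper : ∀ x i, F (x + EuclideanSpace.single i (P i)) = F x := fun x i => hFp x i
  obtain ⟨hA0, hdiff⟩ := core hd3 P (2 * r) (by linarith) hPr F hF2 hper _ _ rfl rfl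
  have hen := energy_s14 (d := n+1) (fun j x => Ψ j (Amap P x))
    (fun j => (hΨ j).continuous.comp (Amap P).continuous) (∏ i, P i)⁻¹ (by positivity)
    (by
      intro j k
      have e := ho j k
      rw [change_var L γ hP] at e
      have hne : ((∏ i, L * γ i : ℝ) : ℂ) ≠ 0 := by exact_mod_cast hVol.ne'
      have e2 : ∫ x in box (n+1), Ψ j (Amap P x) * (starRingEnd ℂ) (Ψ k (Amap P x)) =
          ((∏ i, L * γ i : ℝ) : ℂ)⁻¹ * (if j = k then 1 else 0) := by
        rw [← e, inv_mul_cancel_left₀ hne]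
      rw [e2]
      split_ifs <;> simp [hPdef])
    c hc1 lam E hE hE1 hl (fun x => V (Amap P x)) Vsup (fun x => hV0 _) (fun x => hV _)
    (fun x => F (Amap P x)) (fun x => -lap (n+1) F (Amap P x))
    ((lap_cont F hF2).comp (Amap P).continuous).neg
    (fun x => by rw [hFc]) (fun x => hlapF _) _ _ rfl rfl hA0
  obtain ⟨y₁, hy₁, hn₁⟩ := ball_rep hFp hx₁
  obtain ⟨y₂, hy₂, hn₂⟩ := ball_rep hFp hx₂
  have hyy : ‖y₁ - y₂‖ ≤ 2 * r := by
    have e : y₁ - y₂ = (y₁ - x₀) - (y₂ - x₀) := by abel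
    rw [e]
    have := norm_sub_le (y₁ - x₀) (y₂ - x₀)
    linarith
  have hfin := hdiff y₁ y₂ hyy
  rw [hy₁, hy₂] at hfin
  set AB := (∫ x in box (n+1), (starRingEnd ℂ) (F (Amap P x)) * (-lap (n+1) F (Amap P x))).re +
    (∫ x in box (n+1), (starRingEnd ℂ) (-lap (n+1) F (Amap P x)) * (-lap (n+1) F (Amap P x))).re with hAB
  have hr0 : 0 < r := by linarith
  have h8 : (2 * r) ^ (4 - (n+1)) ≤ 8 * r ^ (4 - (n+1)) := by
    rw [mul_pow]
    refine mul_le_mul_of_nonneg_right ?_ (by positivity)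
    calc (2:ℝ) ^ (4 - (n+1)) ≤ 2 ^ 3 := pow_le_pow_right₀ (by norm_num) (by omega)
      _ = 8 := by norm_num
  have hb : ‖F x₁ - F x₂‖ ^ 2 ≤ (320 * 8 * (16 * 32 * 12 ^ 3)) * r ^ (4 - (n+1)) * (1 + Vsup) ^ 2 * E := by
    have hAB2 : AB * ∏ i, P i ≤ 10 * E + 4 * E * Vsup := by
      have := mul_le_mul_of_nonneg_right hen hVol.le
      rwa [mul_right_comm, inv_mul_cancel₀ hVol.ne', one_mul] at this
    have hR : 0 ≤ r ^ (4 - (n+1)) := by positivity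
    have hR2 : 0 ≤ (2 * r) ^ (4 - (n+1)) := by positivity
    have hQ : 10 * E + 4 * E * Vsup ≤ 10 * ((1 + Vsup) ^ 2 * E) := by nlinarith [mul_nonneg hE.le hVs, mul_nonneg hE.le (sq_nonneg Vsup)]
    have hQ0 : 0 ≤ 10 * ((1 + Vsup) ^ 2 * E) := by positivity
    calc ‖F x₁ - F x₂‖ ^ 2 ≤ 8 * (16 * 32 * 12 ^ 3) * ((AB * ∏ i, P i) * (2 * r) ^ (4 - (n+1))) := by
          refine hfin.trans (le_of_eq ?_); ring
      _ ≤ 8 * (16 * 32 * 12 ^ 3) * ((10 * ((1 + Vsup) ^ 2 * E)) * (8 * r ^ (4 - (n+1)))) := by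
          refine mul_le_mul_of_nonneg_left ?_ (by norm_num)
          exact mul_le_mul (hAB2.trans hQ) h8 hR2 hQ0
      _ ≤ _ := by nlinarith [mul_nonneg hR (mul_nonneg (sq_nonneg (1 + Vsup)) hE.le)]
  have hrp : (r ^ (((4:ℝ) - ((n+1 : ℕ) : ℝ)) / 2)) ^ 2 = r ^ (4 - (n+1)) := by
    rw [← Real.rpow_natCast, ← Real.rpow_mul hr0.le, ← Real.rpow_natCast r (4 - (n+1))]
    congr 1
    rw [Nat.cast_sub (by omega)]
    push_cast; ring
  have hEp : (E ^ ((1:ℝ)/2)) ^ 2 = E := by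
    rw [← Real.sqrt_eq_rpow, Real.sq_sqrt hE.le]
  refine le_of_sq_le_sq ?_ (by positivity)
  refine hb.trans (le_of_eq ?_)
  rw [mul_pow, mul_pow, mul_pow, hrp, hEp, Real.sq_sqrt (by positivity)]
end
end
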